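/- The set of self-intersections of the Riemann zeta function on the critical line is countable; that is, the set of pairs (s₁, s₂) of distinct complex numbers with real part 1/2 such that ζ(s₁) = ζ(s₂) is countable. -/

import Mathlib

open Complex

section

open Filter Topology Set
open scoped Real

theorem exists_real_analytic_germ {g h : ℂ → ℂ} {a b : ℝ} (hga : AnalyticAt ℂ g a)
    (hgb : AnalyticAt ℂ g b) (hha : AnalyticAt ℂ h a) (hhb : AnalyticAt ℂ h b)
    (hab : g a = g b) (hne : deriv g b ≠ 0)
    (hacc : ∃ᶠ p : ℝ × ℝ in 𝓝[≠] (a, b), g p.1 = g p.2 ∧ h p.1 = h p.2) :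
    ∃ ψ : ℝ → ℝ, AnalyticAt ℝ ψ a ∧ ψ a = b ∧
      ∀ᶠ x in 𝓝 a, g (ψ x) = g x ∧ h (ψ x) = h x := by
  set r := hgb.hasStrictDerivAt.localInverse g (deriv g b) b hne with hr
  have hrl : ∀ᶠ z in 𝓝 (b : ℂ), r (g z) = z :=
    hgb.hasStrictDerivAt.eventually_left_inverse hne
  have hrr : ∀ᶠ z in 𝓝 (g b), g (r z) = z :=
    hgb.hasStrictDerivAt.eventually_right_inverse hne
  have hra : AnalyticAt ℂ r (g b) := hgb.analyticAt_localInverse hne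
  have hrb : r (g b) = b := hrl.self_of_nhds
  have hΨ : AnalyticAt ℂ (fun z => r (g z)) (a : ℂ) := AnalyticAt.fun_comp (by rwa [hab]) hga
  have hof : ∀ x : ℝ, AnalyticAt ℝ (fun x : ℝ => (x : ℂ)) x := fun x => ofRealCLM.analyticAt x
  have hΨℝ : AnalyticAt ℝ (fun x : ℝ => r (g x)) a :=
    AnalyticAt.fun_comp (g := fun z : ℂ => r (g z)) (hΨ.restrictScalars (𝕜 := ℝ)) (hof a)
  have him : AnalyticAt ℝ (fun x : ℝ => (r (g x)).im) a :=
    AnalyticAt.fun_comp (imCLM.analyticAt _) hΨℝ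
  have hre : AnalyticAt ℝ (fun x : ℝ => (r (g x)).re) a :=
    AnalyticAt.fun_comp (reCLM.analyticAt _) hΨℝ
  have hfreq : ∃ᶠ x : ℝ in 𝓝[≠] a, (r (g x)).im = 0 ∧ h (r (g x)) - h x = 0 := by
    have h1 : Tendsto (fun p : ℝ × ℝ => ((p.1 : ℂ), (p.2 : ℂ))) (𝓝[≠] (a, b))
        (𝓝 ((a : ℂ), (b : ℂ))) := by
      have : Continuous (fun p : ℝ × ℝ => ((p.1 : ℂ), (p.2 : ℂ))) := by fun_prop
      exact (this.tendsto (a, b)).mono_left nhdsWithin_le_nhds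
    have h2 : ∀ᶠ p : ℝ × ℝ in 𝓝[≠] (a, b), r (g p.2) = p.2 :=
      (continuous_snd.tendsto _ |>.comp h1).eventually hrl
    have h3 : ∃ᶠ p : ℝ × ℝ in 𝓝[≠] (a, b), p.1 ≠ a ∧
        ((r (g p.1)).im = 0 ∧ h (r (g p.1)) - h p.1 = 0) := by
      refine (hacc.and_eventually (h2.and self_mem_nhdsWithin)).mono ?_
      rintro ⟨x, y⟩ ⟨⟨h4, h5⟩, h6, h7⟩
      simp only at h4 h5 h6
      have h8 : r (g x) = y := by rw [h4, h6]
      refine ⟨?_, by simp [h8], by simp [h8, h5]⟩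
      rintro rfl
      apply h7
      rw [hab, hrb] at h8
      simp [← ofReal_inj.mp h8]
    have h4 : Tendsto (fun p : ℝ × ℝ => p.1) (𝓝[≠] (a, b)) (𝓝 a) :=
      (continuous_fst.tendsto (a, b)).mono_left nhdsWithin_le_nhds
    rw [frequently_nhdsWithin_iff]
    exact (h4.frequently (p := fun x : ℝ => x ≠ a ∧ ((r (g x)).im = 0 ∧ h (r (g x)) - h x = 0))
      h3).mono fun x hx => ⟨hx.2, hx.1⟩
  have e1 : ∀ᶠ x : ℝ in 𝓝 a, (r (g x)).im = 0 :=
    him.frequently_zero_iff_eventually_zero.mp (hfreq.mono fun x hx => hx.1)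
  have hh : AnalyticAt ℝ (fun x : ℝ => h (r (g x)) - h x) a := by
    have hra' : r (g a) = b := by rw [hab, hrb]
    have h1 : AnalyticAt ℂ (fun z => h (r (g z)) - h z) (a : ℂ) :=
      (AnalyticAt.fun_comp (f := fun z => r (g z)) (by rwa [hra']) hΨ).sub hha
    exact AnalyticAt.fun_comp (g := fun z : ℂ => h (r (g z)) - h z)
      (h1.restrictScalars (𝕜 := ℝ)) (hof a)
  have e2 : ∀ᶠ x : ℝ in 𝓝 a, h (r (g x)) - h x = 0 :=
    hh.frequently_zero_iff_eventually_zero.mp (hfreq.mono fun x hx => hx.2)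
  have e3 : ∀ᶠ x : ℝ in 𝓝 a, g (r (g x)) = g x := by
    have : Tendsto (fun x : ℝ => g x) (𝓝 a) (𝓝 (g b)) := by
      rw [← hab]
      exact hga.continuousAt.tendsto.comp (continuous_ofReal.tendsto a)
    exact this.eventually hrr
  refine ⟨fun x => (r (g x)).re, hre, by simp [hab, hrb], ?_⟩
  filter_upwards [e1, e2, e3] with x h1 h2 h3
  have h4 : (((r (g x)).re : ℝ) : ℂ) = r (g x) := Complex.ext (by simp) (by simp [h1])
  rw [h4]
  exact ⟨h3, sub_eq_zero.mp h2⟩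

/-- The speed, in the sum norm, of the curve `x ↦ (g x, h x)`. -/
noncomputable def curveSpeed (g h : ℂ → ℂ) (x : ℝ) : ℝ := ‖deriv g x‖ + ‖deriv h x‖

theorem exists_arclength_germ {g h : ℂ → ℂ} {a b : ℝ} (hg : ∀ x : ℝ, AnalyticAt ℂ g x)
    (hh : ∀ x : ℝ, AnalyticAt ℂ h x) (hpos : ∀ x, 0 < curveSpeed g h x)
    {L : ℝ → ℝ} (hL : ∀ x, HasDerivAt L (curveSpeed g h x) x)
    (hgab : g a = g b) (hhab : h a = h b)
    (hacc : ∃ᶠ p : ℝ × ℝ in 𝓝[≠] (a, b), g p.1 = g p.2 ∧ h p.1 = h p.2) :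
    ∃ ε : ℝ, (ε = 1 ∨ ε = -1) ∧ ∃ ψ : ℝ → ℝ, ContinuousAt ψ a ∧ ψ a = b ∧
      ∀ᶠ x in 𝓝 a, (g (ψ x) = g x ∧ h (ψ x) = h x) ∧ L (ψ x) = ε * (L x - L a) + L b := by
  obtain ⟨ψ, hψ, hψa, hψe⟩ : ∃ ψ : ℝ → ℝ, AnalyticAt ℝ ψ a ∧ ψ a = b ∧
      ∀ᶠ x in 𝓝 a, g (ψ x) = g x ∧ h (ψ x) = h x := by
    by_cases hd : deriv g b = 0
    · have hd' : deriv h b ≠ 0 := by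
        intro h0
        have := hpos b
        simp [curveSpeed, hd, h0] at this
      obtain ⟨ψ, h1, h2, h3⟩ := exists_real_analytic_germ (hh a) (hh b) (hg a) (hg b) hhab hd'
        (hacc.mono fun p hp => ⟨hp.2, hp.1⟩)
      exact ⟨ψ, h1, h2, h3.mono fun x hx => ⟨hx.2, hx.1⟩⟩
    · exact exists_real_analytic_germ (hg a) (hg b) (hh a) (hh b) hgab hd hacc
  have key : ∀ f : ℂ → ℂ, (∀ x : ℝ, AnalyticAt ℂ f x) → ∀ x : ℝ, DifferentiableAt ℝ ψ x →
      (∀ᶠ y in 𝓝 x, f (ψ y) = f y) → ‖deriv f (ψ x)‖ * |deriv ψ x| = ‖deriv f x‖ := by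
    intro f hf x hx hfx
    have h1 : HasDerivAt (fun y : ℝ => f y) (deriv f x) x :=
      (hf x).differentiableAt.hasDerivAt.comp_ofReal
    have h2 : HasDerivAt (fun y : ℝ => f y) (deriv f (ψ x)) (ψ x) :=
      (hf (ψ x)).differentiableAt.hasDerivAt.comp_ofReal
    have h3 := h2.scomp x hx.hasDerivAt
    have h4 := (h1.congr_of_eventuallyEq hfx).unique h3
    rw [h4, norm_smul, Real.norm_eq_abs, mul_comm]
  have hspeed : ∀ᶠ x in 𝓝 a, HasDerivAt ψ (deriv ψ x) x ∧
      curveSpeed g h (ψ x) * |deriv ψ x| = curveSpeed g h x := by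
    filter_upwards [hψe.eventually_nhds, hψ.eventually_analyticAt] with x hx hxa
    refine ⟨hxa.differentiableAt.hasDerivAt, ?_⟩
    rw [curveSpeed, curveSpeed, add_mul, key g hg x hxa.differentiableAt (hx.mono fun y hy => hy.1),
      key h hh x hxa.differentiableAt (hx.mono fun y hy => hy.2)]
  have hne : deriv ψ a ≠ 0 := by
    intro h0
    have := hspeed.self_of_nhds.2
    rw [h0] at this
    have := hpos a
    simp_all
  have hcont : ContinuousAt (deriv ψ) a := hψ.deriv.continuousAt
  obtain ⟨ε, hε, hεe⟩ : ∃ ε : ℝ, (ε = 1 ∨ ε = -1) ∧ ∀ᶠ x in 𝓝 a, deriv ψ x = ε * |deriv ψ x| := by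
    rcases lt_or_gt_of_ne hne with hlt | hgt
    · exact ⟨-1, Or.inr rfl, (hcont.eventually_lt continuousAt_const hlt).mono fun x hx => by
        rw [abs_of_neg hx]; ring⟩
    · exact ⟨1, Or.inl rfl, (continuousAt_const.eventually_lt hcont hgt).mono fun x hx => by
        rw [abs_of_pos hx]; ring⟩
  refine ⟨ε, hε, ψ, hψ.continuousAt, hψa, ?_⟩
  have hder : ∀ᶠ x in 𝓝 a, HasDerivAt (fun y => L (ψ y) - ε * L y) 0 x := by
    filter_upwards [hspeed, hεe] with x hx hx2
    have h1 := ((hL (ψ x)).comp x hx.1).sub ((hL x).const_mul ε)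
    refine h1.congr_deriv ?_
    rw [← hx.2, hx2, abs_mul, abs_abs]
    rcases hε with rfl | rfl <;> simp
  obtain ⟨δ, hδ, hball⟩ := Metric.eventually_nhds_iff_ball.mp hder
  filter_upwards [hψe, Metric.ball_mem_nhds a hδ] with x hx hxb
  refine ⟨hx, ?_⟩
  have := (convex_ball a δ).is_const_of_fderivWithin_eq_zero (𝕜 := ℝ)
    (f := fun y => L (ψ y) - ε * L y)
    (fun y hy => (hball y hy).differentiableAt.differentiableWithinAt)
    (fun y hy => by
      rw [fderivWithin_of_isOpen Metric.isOpen_ball hy]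
      ext
      simp [(hball y hy).deriv])
    hxb (Metric.mem_ball_self hδ)
  simp only [hψa] at this
  linarith

theorem eventually_injective_curve {g h : ℂ → ℂ} {b : ℝ} (hg : AnalyticAt ℂ g b)
    (hh : AnalyticAt ℂ h b) (hpos : 0 < curveSpeed g h b) :
    ∃ V ∈ 𝓝 b, ∀ x ∈ V, ∀ y ∈ V, g x = g y → h x = h y → x = y := by
  have key : ∀ f : ℂ → ℂ, AnalyticAt ℂ f b → deriv f b ≠ 0 →
      ∃ V ∈ 𝓝 b, ∀ x ∈ V, ∀ y ∈ V, f (x : ℝ) = f (y : ℝ) → x = y := by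
    intro f hf hd
    have h1 : ∀ᶠ x : ℝ in 𝓝 b, hf.hasStrictDerivAt.localInverse f _ _ hd (f x) = x :=
      (continuous_ofReal.tendsto b).eventually (hf.hasStrictDerivAt.eventually_left_inverse hd)
    refine ⟨_, h1, fun x hx y hy hxy => ?_⟩
    have hx' : hf.hasStrictDerivAt.localInverse f _ _ hd (f x) = x := hx
    have hy' : hf.hasStrictDerivAt.localInverse f _ _ hd (f y) = y := hy
    rw [hxy, hy'] at hx'
    exact (ofReal_inj.mp hx').symm
  by_cases hd : deriv g b = 0
  · have hd' : deriv h b ≠ 0 := by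
      intro h0
      simp [curveSpeed, hd, h0] at hpos
    obtain ⟨V, hV, H⟩ := key h hh hd'
    exact ⟨V, hV, fun x hx y hy _ h2 => H x hx y hy h2⟩
  · obtain ⟨V, hV, H⟩ := key g hg hd
    exact ⟨V, hV, fun x hx y hy h1 _ => H x hx y hy h1⟩

theorem eventually_reparam_of_frequently {g h : ℂ → ℂ} (hg : ∀ x : ℝ, AnalyticAt ℂ g x)
    (hh : ∀ x : ℝ, AnalyticAt ℂ h x) (hpos : ∀ x, 0 < curveSpeed g h x)
    {L : ℝ → ℝ} (hL : ∀ x, HasDerivAt L (curveSpeed g h x) x)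
    {M : ℝ → ℝ} (hM : Continuous M) (hLM : ∀ y, L (M y) = y) (hML : ∀ x, M (L x) = x)
    {ε c : ℝ} {x₀ : ℝ}
    (h₀ : ∀ᶠ x in 𝓝 x₀, g (M (ε * L x + c)) = g x ∧ h (M (ε * L x + c)) = h x) (x : ℝ) :
    g (M (ε * L x + c)) = g x ∧ h (M (ε * L x + c)) = h x := by
  have hLc : Continuous L := continuous_iff_continuousAt.mpr fun x => (hL x).continuousAt
  have hgc : Continuous (fun x : ℝ => g x) := continuous_iff_continuousAt.mpr fun x =>
    (hg x).continuousAt.comp continuous_ofReal.continuousAt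
  have hhc : Continuous (fun x : ℝ => h x) := continuous_iff_continuousAt.mpr fun x =>
    (hh x).continuousAt.comp continuous_ofReal.continuousAt
  set φ : ℝ → ℝ := fun x => M (ε * L x + c) with hφ
  have hφc : Continuous φ := by fun_prop
  set T : Set ℝ := {x | ∀ᶠ y in 𝓝 x, g (φ y) = g y ∧ h (φ y) = h y} with hT
  have hTsub : T ⊆ {x | g (φ x) = g x ∧ h (φ x) = h x} := fun x hx => hx.self_of_nhds
  have hcl : IsClosed {x | g (φ x) = g x ∧ h (φ x) = h x} :=
    (isClosed_eq (hgc.comp hφc) hgc).inter (isClosed_eq (hhc.comp hφc) hhc)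
  have hclopen : IsClopen T := by
    refine ⟨?_, isOpen_setOfPred_eventually_nhds⟩
    refine isClosed_of_closure_subset fun z hz => ?_
    by_contra hzT
    have hzeq : g (φ z) = g z ∧ h (φ z) = h z := closure_minimal hTsub hcl hz
    have hfr : ∃ᶠ x in 𝓝[≠] z, x ∈ T := by
      rw [frequently_nhdsWithin_iff]
      refine (mem_closure_iff_frequently.mp hz).mono fun x hx => ⟨hx, ?_⟩
      rintro rfl
      exact hzT hx
    have htend : Tendsto (fun x => (x, φ x)) (𝓝[≠] z) (𝓝[≠] (z, φ z)) := by
      refine tendsto_nhdsWithin_iff.mpr ⟨?_, ?_⟩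
      · exact ((continuous_id.prodMk hφc).tendsto z).mono_left nhdsWithin_le_nhds
      · filter_upwards [self_mem_nhdsWithin] with x hx
        simp only [mem_compl_iff, mem_singleton_iff, Prod.mk.injEq, not_and] at hx ⊢
        exact fun h => absurd h hx
    have hacc : ∃ᶠ p : ℝ × ℝ in 𝓝[≠] (z, φ z), g p.1 = g p.2 ∧ h p.1 = h p.2 :=
      htend.frequently (hfr.mono fun x hx => ⟨(hTsub hx).1.symm, (hTsub hx).2.symm⟩)
    obtain ⟨ε', hε', ψ, hψc, hψz, hψ⟩ :=
      exists_arclength_germ hg hh hpos hL hzeq.1.symm hzeq.2.symm hacc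
    obtain ⟨V, hV, hinj⟩ := eventually_injective_curve (hg (φ z)) (hh (φ z)) (hpos _)
    have hLφ : ∀ x, L (φ x) = ε * L x + c := fun x => hLM _
    have e1 : ∀ᶠ x in 𝓝 z, φ x ∈ V := hφc.continuousAt hV
    have e2 : ∀ᶠ x in 𝓝 z, ψ x ∈ V := by
      apply hψc
      rwa [hψz]
    have e3 := (e1.and (e2.and hψ)).filter_mono (nhdsWithin_le_nhds (s := {z}ᶜ))
    obtain ⟨x₁, hx₁T, ⟨hx₁1, hx₁2, hx₁3⟩, hx₁ne⟩ :=
      (hfr.and_eventually (e3.and self_mem_nhdsWithin)).exists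
    have heq : ψ x₁ = φ x₁ := hinj _ hx₁2 _ hx₁1 (by rw [hx₁3.1.1, (hTsub hx₁T).1])
      (by rw [hx₁3.1.2, (hTsub hx₁T).2])
    have hLne : L x₁ - L z ≠ 0 := by
      intro h0
      apply hx₁ne
      rw [mem_singleton_iff, ← hML x₁, ← hML z, sub_eq_zero.mp h0]
    have hεε : ε' = ε := by
      have h1 := hx₁3.2
      rw [heq, hLφ, hLφ] at h1
      apply mul_right_cancel₀ hLne
      linarith
    apply hzT
    filter_upwards [hψ] with y hy
    have : ψ y = φ y := by
      rw [← hML (ψ y), hy.2, hLφ, hεε, hφ]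
      congr 1
      ring
    rw [← this]
    exact hy.1
  have : T = univ := hclopen.eq_univ ⟨x₀, h₀⟩
  exact hTsub (this ▸ mem_univ x)

theorem countable_self_intersections_curve {g h : ℂ → ℂ} (hg : ∀ x : ℝ, AnalyticAt ℂ g x)
    (hh : ∀ x : ℝ, AnalyticAt ℂ h x) (himm : ∀ x : ℝ, deriv g x ≠ 0 ∨ deriv h x ≠ 0)
    (htop : ∀ C, ∃ x : ℝ, 0 ≤ x ∧ C < ‖g x‖) (hbot : ∀ C, ∃ x : ℝ, x ≤ 0 ∧ C < ‖g x‖) :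
    {p : ℝ × ℝ | p.1 ≠ p.2 ∧ g p.1 = g p.2 ∧ h p.1 = h p.2}.Countable := by
  have hpos : ∀ x, 0 < curveSpeed g h x := fun x => by
    unfold curveSpeed
    rcases himm x with h1 | h1
    · exact add_pos_of_pos_of_nonneg (norm_pos_iff.mpr h1) (norm_nonneg _)
    · exact add_pos_of_nonneg_of_pos (norm_nonneg _) (norm_pos_iff.mpr h1)
  have hvc : Continuous (curveSpeed g h) := by
    refine continuous_iff_continuousAt.mpr fun x => ?_
    have h1 : ContinuousAt (fun x : ℝ => deriv g x) x :=
      (hg x).deriv.continuousAt.comp continuous_ofReal.continuousAt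
    have h2 : ContinuousAt (fun x : ℝ => deriv h x) x :=
      (hh x).deriv.continuousAt.comp continuous_ofReal.continuousAt
    exact h1.norm.add h2.norm
  set L : ℝ → ℝ := fun x => ∫ t in (0 : ℝ)..x, curveSpeed g h t with hLdef
  have hL : ∀ x, HasDerivAt L (curveSpeed g h x) x := fun x =>
    intervalIntegral.integral_hasDerivAt_right (hvc.intervalIntegrable _ _)
      (hvc.stronglyMeasurableAtFilter _ _) hvc.continuousAt
  have hL0 : L 0 = 0 := by simp [hLdef]
  have hLc : Continuous L := continuous_iff_continuousAt.mpr fun x => (hL x).continuousAt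
  have hmono : StrictMono L := strictMono_of_deriv_pos fun x => by
    rw [(hL x).deriv]; exact hpos x
  have hgd : ∀ x : ℝ, HasDerivAt (fun y : ℝ => g y) (deriv g x) x := fun x =>
    (hg x).differentiableAt.hasDerivAt.comp_ofReal
  have hgv : ∀ x : ℝ, ‖deriv g x‖ ≤ curveSpeed g h x := fun x => by
    unfold curveSpeed
    linarith [norm_nonneg (deriv h x)]
  have hLtop : ∀ x : ℝ, 0 ≤ x → ‖g x - g (0 : ℝ)‖ ≤ L x := fun x hx =>
    image_norm_le_of_norm_deriv_right_le_deriv_boundary (a := 0) (b := x)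
      (f := fun y : ℝ => g y - g (0 : ℝ)) (f' := fun y : ℝ => deriv g y)
      (fun y _ => ((hgd y).sub_const _).continuousAt.continuousWithinAt)
      (fun y _ => ((hgd y).sub_const _).hasDerivWithinAt) (by simp [hL0]) hL
      (fun y _ => hgv y) ⟨hx, le_rfl⟩
  have hLbot : ∀ x : ℝ, x ≤ 0 → ‖g x - g (0 : ℝ)‖ ≤ -L x := fun x hx => by
    have h1 : ∀ y : ℝ, HasDerivAt (fun y : ℝ => g ((-y : ℝ) : ℂ) - g (0 : ℝ))
        (-deriv g ((-y : ℝ) : ℂ)) y := fun y => by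
      have := (hgd (-y)).scomp y (hasDerivAt_neg y)
      simpa using this.sub_const (g (0 : ℝ))
    have h2 : ∀ y : ℝ, HasDerivAt (fun y : ℝ => -L (-y)) (curveSpeed g h (-y)) y := fun y => by
      have := ((hL (-y)).comp y (hasDerivAt_neg y)).neg
      rw [mul_neg_one, neg_neg] at this
      exact this
    have := image_norm_le_of_norm_deriv_right_le_deriv_boundary (a := 0) (b := -x)
      (fun y _ => (h1 y).continuousAt.continuousWithinAt)
      (fun y _ => (h1 y).hasDerivWithinAt) (by simp [hL0]) h2
      (fun y _ => by rw [norm_neg]; exact hgv _) (x := -x) ⟨by linarith, le_rfl⟩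
    simpa using this
  have hsurj : Function.Surjective L := by
    refine hLc.surjective ?_ ?_
    · refine tendsto_atTop_atTop_of_monotone hmono.monotone fun C => ?_
      obtain ⟨x, hx, hC⟩ := htop (C + ‖g (0 : ℝ)‖)
      refine ⟨x, ?_⟩
      have := hLtop x hx
      have := norm_sub_norm_le (g x) (g (0 : ℝ))
      linarith
    · refine tendsto_atBot_atBot_of_monotone hmono.monotone fun C => ?_
      obtain ⟨x, hx, hC⟩ := hbot (-C + ‖g (0 : ℝ)‖)
      refine ⟨x, ?_⟩
      have := hLbot x hx
      have := norm_sub_norm_le (g x) (g (0 : ℝ))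
      linarith
  set e := hmono.orderIsoOfSurjective L hsurj with he
  have heL : ∀ x, e x = L x := fun x => rfl
  have hM : Continuous e.symm := e.symm.continuous
  have hLM : ∀ y, L (e.symm y) = y := fun y => by rw [← heL, e.apply_symm_apply]
  have hML : ∀ x, e.symm (L x) = x := fun x => by rw [← heL, e.symm_apply_apply]
  by_contra hunc
  have hnd : ¬ IsDiscrete {p : ℝ × ℝ | p.1 ≠ p.2 ∧ g p.1 = g p.2 ∧ h p.1 = h p.2} := fun hd =>
    hunc ((HereditarilyLindelofSpace.isLindelof _).countable_of_isDiscrete hd)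
  rw [isDiscrete_iff_nhdsNE] at hnd
  push Not at hnd
  obtain ⟨⟨a, b⟩, ⟨hab, hgab, hhab⟩, hacc⟩ := hnd
  simp only at hab hgab hhab
  have hfreq : ∃ᶠ p : ℝ × ℝ in 𝓝[≠] (a, b), g p.1 = g p.2 ∧ h p.1 = h p.2 := by
    refine Frequently.mono ?_ fun p (hp : p ∈ {p : ℝ × ℝ | p.1 ≠ p.2 ∧ g p.1 = g p.2 ∧
      h p.1 = h p.2}) => hp.2
    exact frequently_iff_neBot.mpr (neBot_iff.mpr hacc.ne)
  obtain ⟨ε, hε, ψ, hψc, hψa, hψ⟩ := exists_arclength_germ hg hh hpos hL hgab hhab hfreq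
  set c := L b - ε * L a with hc
  have hall := eventually_reparam_of_frequently hg hh hpos hL hM hLM hML (ε := ε) (c := c)
    (x₀ := a) (by
      filter_upwards [hψ] with x hx
      have : e.symm (ε * L x + c) = ψ x := by
        rw [← hML (ψ x), hx.2, hc]
        congr 1
        ring
      rw [this]
      exact hx.1)
  rcases hε with rfl | rfl
  · have hc0 : c ≠ 0 := by
      rw [hc, one_mul]
      exact sub_ne_zero.mpr fun h0 => hab (hmono.injective h0.symm)
    have hper : Function.Periodic (fun y : ℝ => g (e.symm y)) c := fun y => by
      have := (hall (e.symm y)).1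
      rwa [hLM, one_mul] at this
    have hcont : Continuous (fun y : ℝ => g (e.symm y)) := continuous_iff_continuousAt.mpr fun y =>
      (hgd (e.symm y)).continuousAt.comp (f := e.symm) hM.continuousAt
    obtain ⟨C, hC⟩ := (hper.isBounded_of_continuous hc0 hcont).exists_norm_le
    obtain ⟨x, -, hx⟩ := htop C
    have := hC (g x) ⟨L x, by simp only [hML]⟩
    linarith
  · set x₀ := e.symm (c / 2) with hx₀
    have hLx₀ : L x₀ = c / 2 := hLM _
    have hφ₀ : e.symm (-1 * L x₀ + c) = x₀ := by
      rw [hLx₀, hx₀]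
      congr 1
      ring
    obtain ⟨V, hV, hinj⟩ := eventually_injective_curve (hg x₀) (hh x₀) (hpos _)
    have hφc : Continuous fun x => e.symm (-1 * L x + c) := by fun_prop
    have e1 : ∀ᶠ x in 𝓝 x₀, e.symm (-1 * L x + c) ∈ V := by
      apply hφc.continuousAt
      simp only [hφ₀]
      exact hV
    have e2 : ∀ᶠ x in 𝓝[≠] x₀, x = x₀ := by
      refine nhdsWithin_le_nhds ?_
      filter_upwards [e1, hV] with x hx1 hx2
      have h1 := hinj _ hx1 _ hx2 (hall x).1 (hall x).2
      have h2 := congrArg L h1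
      rw [hLM] at h2
      apply hmono.injective
      rw [hLx₀]
      linarith
    obtain ⟨x, hx, hx'⟩ := (e2.and self_mem_nhdsWithin).exists
    exact hx' hx

end

section

open Filter Topology Set
open scoped Real Nat

/-- The Euler-Maclaurin approximation of order `m` to `∑ n ≥ x, n ^ (-s)`. -/
noncomputable def zetaTail (m : ℕ) (x : ℝ) (s : ℂ) : ℂ :=
  (x : ℂ) ^ (1 - s) / (s - 1) + ∑ j ∈ Finset.range m,
    ((bernoulliFun (j + 1) 1 / (j + 1)! : ℝ) : ℂ) * (ascPochhammer ℂ j).eval s * (x : ℂ) ^ (-s - j)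

/-- The error made by `zetaTail` between `n` and `n + 1`. -/
noncomputable def zetaTailError (m n : ℕ) (s : ℂ) : ℂ :=
  zetaTail m n s - zetaTail m (n + 1) s - (n : ℂ) ^ (-s)

theorem hasDerivAt_eulerMaclaurin (m : ℕ) {n v : ℝ} (hx : 0 < n + v) {s : ℂ} (hs : s ≠ 1) :
    HasDerivAt (fun v : ℝ => ((n + v : ℝ) : ℂ) ^ (1 - s) / (s - 1) + ∑ j ∈ Finset.range m,
      ((bernoulliFun (j + 1) v / (j + 1)! : ℝ) : ℂ) * (ascPochhammer ℂ j).eval s *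
        ((n + v : ℝ) : ℂ) ^ (-s - j))
      (-(((bernoulliFun m v / m ! : ℝ) : ℂ) * (ascPochhammer ℂ m).eval s *
        ((n + v : ℝ) : ℂ) ^ (-s - m))) v := by
  have hc : ∀ r : ℂ, HasDerivAt (fun v : ℝ => ((n + v : ℝ) : ℂ) ^ r)
      (r * ((n + v : ℝ) : ℂ) ^ (r - 1)) v := fun r => by
    have h1 := ((hasDerivAt_id ((n + v : ℝ) : ℂ)).cpow_const (c := r)
      (Or.inl (by simpa using hx))).comp_ofReal.comp_const_add n v
    simpa using h1
  induction m with
  | zero =>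
    have := (hc (1 - s)).div_const (s - 1)
    simp only [Finset.range_zero, Finset.sum_empty, add_zero]
    refine this.congr_deriv ?_
    have h1 : s - 1 ≠ 0 := sub_ne_zero.mpr hs
    simp only [bernoulliFun_zero, Nat.factorial_zero, ascPochhammer_zero, Polynomial.eval_one]
    rw [show 1 - s - 1 = -s - (0 : ℕ) by push_cast; ring]
    field_simp
    push_cast
    ring
  | succ m ih =>
    simp only [Finset.sum_range_succ, ← add_assoc]
    have h1 : HasDerivAt (fun v : ℝ => ((bernoulliFun (m + 1) v / (m + 1)! : ℝ) : ℂ))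
        ((bernoulliFun m v / m ! : ℝ) : ℂ) v := by
      have h2 := ((hasDerivAt_bernoulliFun (m + 1) v).div_const ((m + 1)! : ℝ)).ofReal_comp
      refine h2.congr_deriv ?_
      rw [Nat.factorial_succ, Nat.add_sub_cancel]
      push_cast
      field_simp
    refine (ih.add ((h1.mul_const ((ascPochhammer ℂ m).eval s)).mul (hc (-s - m)))).congr_deriv ?_
    rw [ascPochhammer_succ_eval, show -s - ((m + 1 : ℕ) : ℂ) = -s - m - 1 by push_cast; ring]
    ring

theorem eulerMaclaurin_sub_eq {m : ℕ} (hm : 1 ≤ m) (n : ℕ) (s : ℂ) :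
    ((((n : ℝ) + 1 : ℝ) : ℂ) ^ (1 - s) / (s - 1) + ∑ j ∈ Finset.range m,
      ((bernoulliFun (j + 1) 1 / (j + 1)! : ℝ) : ℂ) * (ascPochhammer ℂ j).eval s *
        (((n : ℝ) + 1 : ℝ) : ℂ) ^ (-s - j)) -
    ((((n : ℝ) + 0 : ℝ) : ℂ) ^ (1 - s) / (s - 1) + ∑ j ∈ Finset.range m,
      ((bernoulliFun (j + 1) 0 / (j + 1)! : ℝ) : ℂ) * (ascPochhammer ℂ j).eval s *
        (((n : ℝ) + 0 : ℝ) : ℂ) ^ (-s - j)) = -zetaTailError m n s := by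
  obtain ⟨k, rfl⟩ := Nat.exists_eq_add_of_le' hm
  have h1 : ∀ j, bernoulliFun (j + 1 + 1) 1 = bernoulliFun (j + 1 + 1) 0 := fun j => by
    rw [bernoulliFun_eval_one]; simp
  simp only [zetaTailError, zetaTail, Finset.sum_range_succ', h1, add_zero]
  rw [bernoulliFun_eval_one]
  simp [bernoulliFun_one]
  ring

theorem norm_zetaTailError_le {m n : ℕ} (hm : 1 ≤ m) (hn : 1 ≤ n) {s : ℂ} (hs : s ≠ 1)
    (hre : 1 - m < s.re) {K : ℝ} (hK : ∀ v ∈ Icc (0 : ℝ) 1, |bernoulliFun m v| ≤ K) :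
    ‖zetaTailError m n s‖ ≤ K / m ! * ‖(ascPochhammer ℂ m).eval s‖ *
      (((n : ℝ) ^ (1 - s.re - m) - ((n + 1 : ℕ) : ℝ) ^ (1 - s.re - m)) / (s.re + m - 1)) := by
  have hn' : (1 : ℝ) ≤ n := by exact_mod_cast hn
  set C := K / m ! * ‖(ascPochhammer ℂ m).eval s‖ with hC
  have hpos : ∀ v ∈ Icc (0 : ℝ) 1, 0 < (n : ℝ) + v := fun v hv => by linarith [hv.1]
  set f : ℝ → ℂ := fun v : ℝ => ((n + v : ℝ) : ℂ) ^ (1 - s) / (s - 1) + ∑ j ∈ Finset.range m,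
      ((bernoulliFun (j + 1) v / (j + 1)! : ℝ) : ℂ) * (ascPochhammer ℂ j).eval s *
        ((n + v : ℝ) : ℂ) ^ (-s - j) with hf
  have hfd : ∀ v ∈ Icc (0 : ℝ) 1, HasDerivAt (fun v => f v - f 0) _ v := fun v hv =>
    (hasDerivAt_eulerMaclaurin m (hpos v hv) hs).sub_const _
  have hB : ∀ v ∈ Icc (0 : ℝ) 1, HasDerivAt
      (fun v : ℝ => C * (((n : ℝ) ^ (1 - s.re - m) - (n + v) ^ (1 - s.re - m)) / (s.re + m - 1)))
      (C * (n + v) ^ (-s.re - m)) v := fun v hv => by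
    have h1 := ((((hasDerivAt_id v).const_add (n : ℝ)).rpow_const (p := 1 - s.re - m)
      (Or.inl (hpos v hv).ne')).const_sub ((n : ℝ) ^ (1 - s.re - m))).div_const (s.re + m - 1)
    refine (h1.const_mul C).congr_deriv ?_
    have : s.re + m - 1 ≠ 0 := by linarith
    rw [show 1 - s.re - m - 1 = -s.re - m by ring, id]
    field_simp
    ring
  have key := image_norm_le_of_norm_deriv_right_le_deriv_boundary' (a := 0) (b := 1)
      (f := fun v => f v - f 0)
      (fun v hv => (hfd v hv).continuousAt.continuousWithinAt)
      (fun v hv => (hfd v ⟨hv.1, hv.2.le⟩).hasDerivWithinAt) (by simp)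
      (fun v hv => (hB v hv).continuousAt.continuousWithinAt)
      (fun v hv => (hB v ⟨hv.1, hv.2.le⟩).hasDerivWithinAt)
      (fun v hv => by
        rw [norm_neg, norm_mul, norm_mul, norm_cpow_eq_rpow_re_of_pos (hpos v ⟨hv.1, hv.2.le⟩)]
        rw [norm_real, Real.norm_eq_abs, abs_div, hC]
        simp only [sub_re, neg_re, natCast_re, Nat.abs_cast]
        have := hK v ⟨hv.1, hv.2.le⟩
        have := (hpos v ⟨hv.1, hv.2.le⟩).le
        gcongr) (right_mem_Icc.mpr zero_le_one)
  rw [hf] at key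
  simp only [eulerMaclaurin_sub_eq hm n s, norm_neg] at key
  exact_mod_cast key

theorem norm_zetaTailError_le' {m n : ℕ} (hm : 1 ≤ m) (hn : 1 ≤ n) {s : ℂ} (hs : s ≠ 1)
    (hre : 2 - m ≤ s.re) {K : ℝ} (hK : ∀ v ∈ Icc (0 : ℝ) 1, |bernoulliFun m v| ≤ K) :
    ‖zetaTailError m n s‖ ≤ K / m ! * ‖(ascPochhammer ℂ m).eval s‖ * (n : ℝ) ^ (-2 : ℝ) := by
  have hn' : (1 : ℝ) ≤ n := by exact_mod_cast hn
  have hpos : ∀ v ∈ Icc (0 : ℝ) 1, 0 < (n : ℝ) + v := fun v hv => by linarith [hv.1]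
  rw [← norm_neg, ← eulerMaclaurin_sub_eq hm n s]
  refine norm_image_sub_le_of_norm_deriv_le_segment_01'
    (f := fun v : ℝ => ((n + v : ℝ) : ℂ) ^ (1 - s) / (s - 1) + ∑ j ∈ Finset.range m,
      ((bernoulliFun (j + 1) v / (j + 1)! : ℝ) : ℂ) * (ascPochhammer ℂ j).eval s *
        ((n + v : ℝ) : ℂ) ^ (-s - j))
    (fun v hv => (hasDerivAt_eulerMaclaurin m (hpos v hv) hs).hasDerivWithinAt) fun v hv => ?_
  have h0 := hpos v ⟨hv.1, hv.2.le⟩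
  rw [norm_neg, norm_mul, norm_mul, norm_cpow_eq_rpow_re_of_pos h0]
  rw [norm_real, Real.norm_eq_abs, abs_div]
  simp only [sub_re, neg_re, natCast_re, Nat.abs_cast]
  have := hK v ⟨hv.1, hv.2.le⟩
  have h2 : ((n : ℝ) + v) ^ (-s.re - m) ≤ (n : ℝ) ^ (-2 : ℝ) :=
    (Real.rpow_le_rpow_of_exponent_le (by linarith [hv.1]) (by linarith)).trans
      (Real.rpow_le_rpow_of_nonpos (by linarith) (by linarith [hv.1]) (by norm_num))
  have hK0 : 0 ≤ K := (abs_nonneg _).trans this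
  gcongr

theorem sum_zetaTailError (m N M : ℕ) (s : ℂ) :
    ∑ n ∈ Finset.range M, zetaTailError m (n + (N + 1)) s =
      zetaTail m (N + 1) s - zetaTail m (N + 1 + M) s -
        (∑ k ∈ Finset.range (M + N), 1 / (k + 1 : ℂ) ^ s -
          ∑ k ∈ Finset.range N, 1 / (k + 1 : ℂ) ^ s) := by
  induction M with
  | zero => simp
  | succ M ih =>
    rw [Finset.sum_range_succ, ih, show M + 1 + N = M + N + 1 by ring, Finset.sum_range_succ,
      zetaTailError, cpow_neg]
    push_cast
    rw [show (M : ℝ) + (N + 1) = N + 1 + M by ring,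
      show (M : ℂ) + (N + 1) = M + N + 1 by ring,
      show (N : ℝ) + 1 + M + 1 = N + 1 + (M + 1) by ring]
    ring

theorem tendsto_zetaTail (m : ℕ) {s : ℂ} (hs : 1 < s.re) :
    Tendsto (fun x : ℝ => zetaTail m x s) atTop (𝓝 0) := by
  have h1 : ∀ r : ℂ, r.re < 0 → Tendsto (fun x : ℝ => (x : ℂ) ^ r) atTop (𝓝 0) := fun r hr => by
    rw [tendsto_zero_iff_norm_tendsto_zero]
    refine (tendsto_rpow_neg_atTop (y := -r.re) (by linarith)).congr' ?_
    filter_upwards [eventually_gt_atTop 0] with x hx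
    rw [norm_cpow_eq_rpow_re_of_pos hx, neg_neg]
  have h2 : Tendsto (fun x : ℝ => zetaTail m x s) atTop (𝓝 (0 / (s - 1) +
      ∑ j ∈ Finset.range m, ((bernoulliFun (j + 1) 1 / (j + 1)! : ℝ) : ℂ) *
        (ascPochhammer ℂ j).eval s * 0)) := by
    unfold zetaTail
    refine ((h1 _ (by simpa using hs)).div_const _).add (tendsto_finsetSum _ fun j _ => ?_)
    refine (h1 _ ?_).const_mul _
    simp only [sub_re, neg_re, natCast_re]
    linarith [(Nat.cast_nonneg j : (0 : ℝ) ≤ j)]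
  simpa using h2

theorem differentiableAt_zetaTail (m : ℕ) {x : ℝ} (hx : 0 < x) {s : ℂ} (hs : s ≠ 1) :
    DifferentiableAt ℂ (fun s => zetaTail m x s) s := by
  have hx' : (x : ℂ) ≠ 0 := by exact_mod_cast hx.ne'
  unfold zetaTail
  refine DifferentiableAt.add (DifferentiableAt.div ?_ (by fun_prop) (sub_ne_zero.mpr hs)) ?_
  · exact (differentiableAt_id.const_sub 1).const_cpow (Or.inl hx')
  · refine DifferentiableAt.fun_sum fun j _ => DifferentiableAt.mul ?_ ?_
    · exact ((ascPochhammer ℂ j).differentiable _).const_mul _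
    · exact (differentiableAt_id.neg.sub_const _).const_cpow (Or.inl hx')

theorem differentiableAt_zetaTailError (m : ℕ) {n : ℕ} (hn : 1 ≤ n) {s : ℂ} (hs : s ≠ 1) :
    DifferentiableAt ℂ (zetaTailError m n) s := by
  have hn' : (0 : ℝ) < n := by exact_mod_cast hn
  unfold zetaTailError
  refine ((differentiableAt_zetaTail m hn' hs).sub
    (differentiableAt_zetaTail m (by linarith) hs)).sub ?_
  exact differentiableAt_id.neg.const_cpow (Or.inl (by exact_mod_cast hn'.ne'))

theorem riemannZeta_eq_sub_tsum_zetaTailError {m : ℕ} (hm : 2 ≤ m) (N : ℕ) {s : ℂ}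
    (hre : 2 - m < s.re) (him : 0 < s.im) :
    riemannZeta s = ∑ k ∈ Finset.range N, 1 / (k + 1 : ℂ) ^ s + zetaTail m (N + 1) s -
      ∑' n, zetaTailError m (n + (N + 1)) s := by
  have hm' : (2 : ℝ) ≤ m := by exact_mod_cast hm
  obtain ⟨K, hK⟩ := isCompact_Icc.exists_bound_of_continuousOn
    ((continuous_bernoulliFun (k := m)).continuousOn (s := Icc (0 : ℝ) 1))
  set R := ‖s‖ + 4
  set U : Set ℂ := ({z | 2 - m < z.re} ∩ {z | 0 < z.im}) ∩ Metric.ball 0 R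
  have hUo : IsOpen U := ((isOpen_lt continuous_const continuous_re).inter
    (isOpen_lt continuous_const continuous_im)).inter Metric.isOpen_ball
  have hUc : Convex ℝ U := ((convex_halfSpace_re_gt _).inter (convex_halfSpace_im_gt _)).inter
    (convex_ball _ _)
  have hU1 : ∀ z ∈ U, z ≠ 1 := by
    rintro z ⟨⟨-, hz⟩, -⟩ rfl
    simp at hz
  have hsU : s ∈ U := ⟨⟨hre, him⟩, by simp [R]⟩
  have h2U : 2 + I ∈ U := by
    refine ⟨⟨by simp; linarith, by simp⟩, ?_⟩
    rw [mem_ball_zero_iff]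
    have := norm_add_le (2 : ℂ) I
    simp only [norm_I, Complex.norm_ofNat] at this
    have := norm_nonneg s
    simp only [R]
    linarith
  obtain ⟨A, hA⟩ := (isCompact_closedBall (0 : ℂ) R).exists_bound_of_continuousOn
    ((ascPochhammer ℂ m).continuous.continuousOn)
  have hbd : ∀ (n : ℕ), ∀ z ∈ U, ‖zetaTailError m (n + (N + 1)) z‖ ≤
      K / m ! * A * ((n + (N + 1) : ℕ) : ℝ) ^ (-2 : ℝ) := fun n z hz => by
    refine (norm_zetaTailError_le' (by omega) (by omega) (hU1 z hz) hz.1.1.le hK).trans ?_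
    have hK0 : 0 ≤ K := (norm_nonneg _).trans (hK 0 (by simp))
    have := hA z (Metric.ball_subset_closedBall hz.2)
    gcongr
  have hsum : Summable fun n : ℕ => K / m ! * A * ((n + (N + 1) : ℕ) : ℝ) ^ (-2 : ℝ) := by
    refine Summable.mul_left _ ?_
    rw [summable_nat_add_iff (f := fun n : ℕ => (n : ℝ) ^ (-2 : ℝ)), Real.summable_nat_rpow]
    norm_num
  have hd1 : DifferentiableOn ℂ (fun z => ∑' n, zetaTailError m (n + (N + 1)) z) U :=
    differentiableOn_tsum_of_summable_norm hsum (fun n z hz =>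
      (differentiableAt_zetaTailError m (by omega) (hU1 z hz)).differentiableWithinAt) hUo hbd
  have hd2 : DifferentiableOn ℂ (fun z => ∑ k ∈ Finset.range N, 1 / (k + 1 : ℂ) ^ z +
      zetaTail m (N + 1) z - ∑' n, zetaTailError m (n + (N + 1)) z) U := by
    refine DifferentiableOn.sub (fun z hz => ?_) hd1
    refine (DifferentiableAt.add ?_
      (differentiableAt_zetaTail m (by positivity) (hU1 z hz))).differentiableWithinAt
    refine DifferentiableAt.fun_sum fun k _ => ?_
    have hk : (k + 1 : ℂ) ≠ 0 := Nat.cast_add_one_ne_zero k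
    exact DifferentiableAt.div (by fun_prop) (differentiableAt_id.const_cpow (Or.inl hk))
      (by simp [cpow_eq_zero_iff, hk])
  have hd3 : DifferentiableOn ℂ riemannZeta U := fun z hz =>
    (differentiableAt_riemannZeta (hU1 z hz)).differentiableWithinAt
  refine (hd3.analyticOnNhd hUo).eqOn_of_preconnected_of_eventuallyEq
    (hd2.analyticOnNhd hUo) hUc.isPreconnected h2U ?_ hsU
  filter_upwards [hUo.mem_nhds h2U, (isOpen_lt (f := fun _ => (1 : ℝ)) continuous_const
    continuous_re).mem_nhds (by simp : 1 < (2 + I).re)] with z hz hz1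
  have t1 := (Summable.of_norm_bounded hsum fun n => hbd n z hz).hasSum.tendsto_sum_nat
  simp only [sum_zetaTailError] at t1
  have hz' : Summable fun n : ℕ => 1 / (n + 1 : ℂ) ^ z := by
    have := (summable_nat_add_iff 1).mpr (Complex.summable_one_div_nat_cpow.mpr hz1)
    exact_mod_cast this
  have t2 := (tendsto_add_atTop_iff_nat N).mpr hz'.hasSum.tendsto_sum_nat
  rw [← zeta_eq_tsum_one_div_nat_add_one_cpow hz1] at t2
  have t3 : Tendsto (fun M : ℕ => zetaTail m (N + 1 + M) z) atTop (𝓝 0) :=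
    (tendsto_zetaTail m hz1).comp
      (tendsto_atTop_add_const_left _ _ tendsto_natCast_atTop_atTop)
  have t4 := ((tendsto_const_nhds (x := zetaTail m (N + 1) z)).sub t3).sub
    (t2.sub (tendsto_const_nhds (x := ∑ k ∈ Finset.range N, 1 / (k + 1 : ℂ) ^ z)))
  have := tendsto_nhds_unique t1 t4
  rw [this]
  ring

theorem norm_riemannZeta_sub_le {m : ℕ} (hm : 2 ≤ m) (N : ℕ) {s : ℂ}
    (hre : 2 - m < s.re) (him : 0 < s.im) {K : ℝ}
    (hK : ∀ v ∈ Icc (0 : ℝ) 1, |bernoulliFun m v| ≤ K) :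
    ‖riemannZeta s - (∑ k ∈ Finset.range N, 1 / (k + 1 : ℂ) ^ s + zetaTail m (N + 1) s)‖ ≤
      K / m ! * ‖(ascPochhammer ℂ m).eval s‖ *
        (((N + 1 : ℕ) : ℝ) ^ (1 - s.re - m) / (s.re + m - 1)) := by
  have hs1 : s ≠ 1 := by
    rintro rfl
    simp at him
  have hK0 : 0 ≤ K := (abs_nonneg _).trans (hK 0 (by simp))
  rw [riemannZeta_eq_sub_tsum_zetaTailError hm N hre him, sub_sub_cancel_left, norm_neg]
  have hsum : Summable fun n => zetaTailError m (n + (N + 1)) s := by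
    refine Summable.of_norm_bounded (g := fun n : ℕ => K / m ! * ‖(ascPochhammer ℂ m).eval s‖ *
      ((n + (N + 1) : ℕ) : ℝ) ^ (-2 : ℝ)) (Summable.mul_left _ ?_) fun n =>
      norm_zetaTailError_le' (by omega) (by omega) hs1 hre.le hK
    rw [summable_nat_add_iff (f := fun n : ℕ => (n : ℝ) ^ (-2 : ℝ)), Real.summable_nat_rpow]
    norm_num
  refine le_of_tendsto hsum.hasSum.tendsto_sum_nat.norm (Eventually.of_forall fun M => ?_)
  refine (norm_sum_le_of_le _ fun n _ => norm_zetaTailError_le (by omega) (by omega) hs1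
    (by linarith) hK).trans ?_
  rw [← Finset.mul_sum, ← Finset.sum_div]
  have h0 : 0 ≤ s.re + m - 1 := by linarith
  gcongr
  have h1 : ∀ M : ℕ, ∑ n ∈ Finset.range M, (((n + (N + 1) : ℕ) : ℝ) ^ (1 - s.re - m) -
      ((n + (N + 1) + 1 : ℕ) : ℝ) ^ (1 - s.re - m)) = ((N + 1 : ℕ) : ℝ) ^ (1 - s.re - m) -
      ((M + (N + 1) : ℕ) : ℝ) ^ (1 - s.re - m) := fun M => by
    have := Finset.sum_range_sub' (fun n : ℕ => ((n + (N + 1) : ℕ) : ℝ) ^ (1 - s.re - m)) M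
    simp only [zero_add] at this
    rw [← this]
    refine Finset.sum_congr rfl fun n _ => ?_
    rw [show n + (N + 1) + 1 = n + 1 + (N + 1) by ring]
  rw [h1]
  linarith [Real.rpow_nonneg (Nat.cast_nonneg (α := ℝ) (M + (N + 1))) (1 - s.re - m)]

theorem bernoulli_six : bernoulli 6 = 1 / 42 := by
  rw [bernoulli_eq_bernoulli'_of_ne_one (by norm_num), bernoulli'_def]
  have h5 : bernoulli' 5 = 0 := bernoulli'_eq_zero_of_odd (by decide) (by norm_num)
  norm_num [Finset.sum_range_succ, h5, Nat.choose]

theorem bernoulliFun_seven (x : ℝ) :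
    bernoulliFun 7 x = x ^ 7 - 7 / 2 * x ^ 6 + 7 / 2 * x ^ 5 - 7 / 6 * x ^ 3 + x / 6 := by
  have h3 : bernoulli 3 = 0 := bernoulli_eq_zero_of_odd (by decide) (by norm_num)
  have h4 : bernoulli 4 = -1 / 30 := by
    rw [bernoulli_eq_bernoulli'_of_ne_one (by norm_num), bernoulli'_four]
  have h5 : bernoulli 5 = 0 := bernoulli_eq_zero_of_odd (by decide) (by norm_num)
  have h7 : bernoulli 7 = 0 := bernoulli_eq_zero_of_odd (by decide) (by norm_num)
  simp [bernoulliFun, Polynomial.bernoulli, Finset.sum_range_succ, h3, h4, h5, h7, bernoulli_six,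
    Nat.choose, bernoulli_one, bernoulli_two, ← Polynomial.C_mul_X_pow_eq_monomial]
  ring

theorem abs_bernoulliFun_seven_le {v : ℝ} (hv : v ∈ Icc (0 : ℝ) 1) :
    |bernoulliFun 7 v| ≤ 1 / 30 := by
  rw [bernoulliFun_seven]
  obtain ⟨h0, h1⟩ := hv
  have e : v ^ 7 - 7 / 2 * v ^ 6 + 7 / 2 * v ^ 5 - 7 / 6 * v ^ 3 + v / 6 =
    -((v - 1 / 2) * (1 / 4 - (v - 1 / 2) ^ 2) *
      (31 / 48 - 3 / 2 * (v - 1 / 2) ^ 2 + (v - 1 / 2) ^ 4)) := by ring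
  rw [e, abs_neg, abs_mul]
  set w := v - 1 / 2 with hw
  have hw1 : w ≤ 1 / 2 := by linarith
  have hw2 : -(1 / 2) ≤ w := by linarith
  have hsq : w ^ 2 ≤ 1 / 4 := by nlinarith
  have b1 : |w * (1 / 4 - w ^ 2)| ≤ 49 / 1000 := by
    rw [abs_le]
    constructor
    · nlinarith [mul_nonneg (sq_nonneg (w + 29 / 100)) (by linarith : (0 : ℝ) ≤ 1 / 2 - w),
        sq_nonneg (w + 29 / 100)]
    · nlinarith [mul_nonneg (sq_nonneg (w - 29 / 100)) (by linarith : (0 : ℝ) ≤ 1 / 2 + w),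
        sq_nonneg (w - 29 / 100)]
  have b2 : |31 / 48 - 3 / 2 * w ^ 2 + w ^ 4| ≤ 31 / 48 := by
    rw [abs_le]
    constructor <;> nlinarith [sq_nonneg w, sq_nonneg (w ^ 2)]
  calc _ ≤ 49 / 1000 * (31 / 48 : ℝ) := by gcongr
    _ ≤ 1 / 30 := by norm_num

theorem two_cpow_mul_zetaTail_seven (s : ℂ) :
    2 ^ s * zetaTail 7 2 s = 2 / (s - 1) + 1 / 2 + s / 24 - s * (s + 1) * (s + 2) / 5760 +
      s * (s + 1) * (s + 2) * (s + 3) * (s + 4) / 967680 := by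
  have h3 : bernoulli 3 = 0 := bernoulli_eq_zero_of_odd (by decide) (by norm_num)
  have h4 : bernoulli 4 = -1 / 30 := by
    rw [bernoulli_eq_bernoulli'_of_ne_one (by norm_num), bernoulli'_four]
  have h5 : bernoulli 5 = 0 := bernoulli_eq_zero_of_odd (by decide) (by norm_num)
  have h7 : bernoulli 7 = 0 := bernoulli_eq_zero_of_odd (by decide) (by norm_num)
  have e : ∀ r : ℂ, (2 : ℂ) ^ s * 2 ^ (r - s) = 2 ^ r := fun r => by
    rw [← cpow_add _ _ two_ne_zero, add_sub_cancel]
  have e' : ∀ n : ℕ, (2 : ℂ) ^ (-s - n) = 2 ^ (-s) * (2 ^ n)⁻¹ := fun n => by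
    rw [sub_eq_add_neg, cpow_add _ _ two_ne_zero, cpow_neg _ (n : ℂ), cpow_natCast]
  have e0 : (2 : ℂ) ^ s * 2 ^ (-s) = 1 := by
    rw [← cpow_add _ _ two_ne_zero, add_neg_cancel, cpow_zero]
  have e1 : (2 : ℂ) ^ s * 2 ^ (1 - s) = 2 := by
    rw [← cpow_add _ _ two_ne_zero, add_sub_cancel, cpow_one]
  simp only [zetaTail, ofReal_ofNat, e', mul_add, Finset.mul_sum]
  rw [mul_div_assoc', e1]
  have : ∀ a b c : ℂ, 2 ^ s * (a * b * (2 ^ (-s) * c)) = a * b * c := fun a b c => by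
    linear_combination a * b * c * e0
  simp only [this, Finset.sum_range_succ, bernoulliFun_eval_one, bernoulliFun_eval_zero]
  simp [ascPochhammer_succ_eval, h3, h4, h5, h7, bernoulli_six, bernoulli_one, bernoulli_two,
    Nat.factorial]
  ring

/-- The main part of `2 ^ s * (riemannZeta s - 1)` given by the Euler-Maclaurin formula. -/
noncomputable def zetaMain (s : ℂ) : ℂ :=
  2 / (s - 1) + 1 / 2 + s / 24 - s * (s + 1) * (s + 2) / 5760 +
    s * (s + 1) * (s + 2) * (s + 3) * (s + 4) / 967680

/-- The derivative of `zetaMain`. -/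
noncomputable def zetaMainDeriv (s : ℂ) : ℂ :=
  -2 / (s - 1) ^ 2 + 1 / 24 - (3 * s ^ 2 + 6 * s + 2) / 5760 +
    (5 * s ^ 4 + 40 * s ^ 3 + 105 * s ^ 2 + 100 * s + 24) / 967680

theorem hasDerivAt_zetaMain {s : ℂ} (hs : s ≠ 1) :
    HasDerivAt zetaMain (zetaMainDeriv s) s := by
  have hs' : s - 1 ≠ 0 := sub_ne_zero.mpr hs
  have h1 := (hasDerivAt_const s (2 : ℂ)).div ((hasDerivAt_id s).sub_const 1) hs'
  have h2 : HasDerivAt (fun s : ℂ => s * (s + 1) * (s + 2)) (3 * s ^ 2 + 6 * s + 2) s := by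
    have := ((hasDerivAt_id s).mul ((hasDerivAt_id s).add_const 1)).mul
      ((hasDerivAt_id s).add_const 2)
    exact this.congr_deriv (by simp; ring)
  have h3 := (h2.mul ((hasDerivAt_id s).add_const 3)).mul ((hasDerivAt_id s).add_const 4)
  refine ((((h1.add_const (1 / 2)).add ((hasDerivAt_id s).div_const 24)).sub
    (h2.div_const 5760)).add (h3.div_const 967680)).congr_deriv ?_
  simp only [zetaMainDeriv, id, Pi.mul_apply]
  ring

theorem re_zetaMainDeriv_sub (t l : ℝ) :
    (zetaMainDeriv (1 / 2 + t * I) - l * zetaMain (1 / 2 + t * I)).re =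
      -2 * (1 / 4 - t ^ 2) / (1 / 4 + t ^ 2) ^ 2 + 1 / 24 - (23 / 4 - 3 * t ^ 2) / 5760 +
      (1689 / 16 - 345 / 2 * t ^ 2 + 5 * t ^ 4) / 967680
       - l * (-1 / (1 / 4 + t ^ 2) + 1 / 2 + 1 / 48 - (15 / 8 - 9 / 2 * t ^ 2) / 5760 +
        (945 / 32 - 475 / 4 * t ^ 2 + 25 / 2 * t ^ 4) / 967680) := by
  have hD : (1 / 4 + t ^ 2 : ℝ) ≠ 0 := by positivity
  obtain ⟨r, hr⟩ : ∃ r : ℝ, r = (1 / 4 + t ^ 2)⁻¹ := ⟨_, rfl⟩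
  have hr1 : (1 / 4 + t ^ 2) * r = 1 := by rw [hr, mul_inv_cancel₀ hD]
  have hr1c : (1 / 4 + t ^ 2 : ℂ) * r = 1 := by simpa using congrArg ofReal hr1
  have hne : (1 / 2 + t * I - 1 : ℂ) ≠ 0 := by
    intro h0
    have := congrArg re h0
    norm_num at this
  have i1 : (2 : ℂ) / (1 / 2 + t * I - 1) = ((-r : ℝ) : ℂ) + ((-2 * t * r : ℝ) : ℂ) * I := by
    rw [div_eq_iff hne]
    push_cast
    linear_combination -2 * hr1c + 2 * t ^ 2 * r * I_sq
  have i2 : (-2 : ℂ) / (1 / 2 + t * I - 1) ^ 2 =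
      ((-2 * (1 / 4 - t ^ 2) * r ^ 2 : ℝ) : ℂ) + ((-2 * t * r ^ 2 : ℝ) : ℂ) * I := by
    have : (-2 : ℂ) / (1 / 2 + t * I - 1) ^ 2 = -(2 / (1 / 2 + t * I - 1)) ^ 2 / 2 := by
      field_simp
    rw [this, i1]
    push_cast
    linear_combination -2 * t ^ 2 * r ^ 2 * I_sq
  have e1 : -2 * (1 / 4 - t ^ 2) / (1 / 4 + t ^ 2) ^ 2 = -2 * (1 / 4 - t ^ 2) * r ^ 2 := by
    rw [hr, inv_pow, div_eq_mul_inv]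
  have e2 : -1 / (1 / 4 + t ^ 2) = -r := by rw [hr, div_eq_mul_inv, neg_one_mul]
  rw [zetaMainDeriv, zetaMain, i1, i2, e1, e2]
  simp only [div_eq_inv_mul, pow_succ, pow_zero, one_mul]
  norm_num
  ring

theorem re_zetaMainDeriv_sub_le {t l : ℝ} (ht : 11 / 2 ≤ t) (ht' : t ≤ 7) (hl : 0.69 ≤ l) :
    (zetaMainDeriv (1 / 2 + t * I) - l * zetaMain (1 / 2 + t * I)).re ≤ -1 / 5 := by
  rw [re_zetaMainDeriv_sub, show t ^ 4 = (t ^ 2) ^ 2 by ring]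
  have h1 : 30 ≤ t ^ 2 := by nlinarith
  have h2 : t ^ 2 ≤ 49 := by nlinarith
  generalize t ^ 2 = T at h1 h2
  have hD : 0 < 1 / 4 + T := by linarith
  have b1 : -2 * (1 / 4 - T) / (1 / 4 + T) ^ 2 ≤ 2 / 30 := by
    rw [div_le_iff₀ (by positivity)]
    nlinarith
  have b2 : -1 / 30 ≤ -1 / (1 / 4 + T) := by
    rw [le_div_iff₀ hD]
    nlinarith
  have b3 : 0.479 ≤ -1 / (1 / 4 + T) + 1 / 2 + 1 / 48 - (15 / 8 - 9 / 2 * T) / 5760 +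
        (945 / 32 - 475 / 4 * T + 25 / 2 * T ^ 2) / 967680 := by
    nlinarith
  have b4 : 0.69 * 0.479 ≤ l * (-1 / (1 / 4 + T) + 1 / 2 + 1 / 48 - (15 / 8 - 9 / 2 * T) / 5760 +
        (945 / 32 - 475 / 4 * T + 25 / 2 * T ^ 2) / 967680) := by
    gcongr
  nlinarith

theorem norm_two_cpow_mul_riemannZeta_sub_le {s : ℂ} (hre : -5 < s.re) (him : 0 < s.im) :
    ‖2 ^ s * (riemannZeta s - 1) - zetaMain s‖ ≤
      ‖(ascPochhammer ℂ 7).eval s‖ / (9676800 * (s.re + 6)) := by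
  have h := norm_riemannZeta_sub_le (m := 7) (by norm_num) 1 (s := s)
    (by norm_num; linarith) him (K := 1 / 30) fun v hv => abs_bernoulliFun_seven_le hv
  have e1 : (∑ k ∈ Finset.range 1, 1 / (k + 1 : ℂ) ^ s) = 1 := by simp
  rw [e1, show ((1 : ℕ) : ℝ) + 1 = 2 by norm_num, show ((1 + 1 : ℕ) : ℝ) = 2 by norm_num] at h
  have e2 : 2 ^ s * (riemannZeta s - 1) - zetaMain s =
      2 ^ s * (riemannZeta s - (1 + zetaTail 7 2 s)) := by
    rw [zetaMain, ← two_cpow_mul_zetaTail_seven]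
    ring
  have e3 : ‖(2 : ℂ) ^ s‖ = 2 ^ s.re := by
    have := norm_cpow_eq_rpow_re_of_pos (x := 2) two_pos s
    exact_mod_cast this
  have e4 : (2 : ℝ) ^ s.re * 2 ^ (1 - s.re - (7 : ℕ)) = 1 / 64 := by
    rw [← Real.rpow_add two_pos, show s.re + (1 - s.re - (7 : ℕ)) = ((-6 : ℤ) : ℝ) by
      push_cast; ring, Real.rpow_intCast]
    norm_num
  have h6 : 0 < s.re + 6 := by linarith
  rw [e2, norm_mul, e3]
  calc _ ≤ (2 : ℝ) ^ s.re * (1 / 30 / (7)! * ‖(ascPochhammer ℂ 7).eval s‖ *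
        (2 ^ (1 - s.re - (7 : ℕ)) / (s.re + (7 : ℕ) - 1))) := by gcongr
    _ = ((2 : ℝ) ^ s.re * 2 ^ (1 - s.re - (7 : ℕ))) *
        (1 / 30 / (7)! * ‖(ascPochhammer ℂ 7).eval s‖ / (s.re + 6)) := by
      rw [show s.re + (7 : ℕ) - 1 = s.re + 6 by push_cast; ring]
      ring
    _ = _ := by
      rw [e4]
      norm_num [Nat.factorial]
      field_simp
      ring

theorem norm_ascPochhammer_seven_le {s : ℂ} {t : ℝ} (ht : 0 ≤ t) (ht' : t ≤ 7)
    (hs : ‖s - (1 / 2 + t * I)‖ ≤ 1) : ‖(ascPochhammer ℂ 7).eval s‖ ≤ 4800000 := by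
  have h : ∀ (a c : ℝ), 0 ≤ c → (a + 1 / 2) ^ 2 + 49 ≤ c ^ 2 → ‖s + a‖ ≤ c + 1 := by
    intro a c hc hac
    have h1 : ‖((a + 1 / 2 : ℝ) : ℂ) + t * I‖ ≤ c := by
      refine abs_le_of_sq_le_sq' ?_ hc |>.2
      rw [norm_add_mul_I, Real.sq_sqrt (by positivity)]
      nlinarith
    calc ‖s + a‖ = ‖(((a + 1 / 2 : ℝ) : ℂ) + t * I) + (s - (1 / 2 + t * I))‖ := by
          congr 1; push_cast; ring
      _ ≤ c + 1 := (norm_add_le _ _).trans (add_le_add h1 hs)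
  have h0 := h 0 7.02 (by norm_num) (by norm_num)
  have h1 := h 1 7.16 (by norm_num) (by norm_num)
  have h2 := h 2 7.44 (by norm_num) (by norm_num)
  have h3 := h 3 7.83 (by norm_num) (by norm_num)
  have h4 := h 4 8.33 (by norm_num) (by norm_num)
  have h5 := h 5 8.91 (by norm_num) (by norm_num)
  have h6 := h 6 9.56 (by norm_num) (by norm_num)
  simp only [ofReal_zero, add_zero, ofReal_one, ofReal_ofNat] at h0 h1 h2 h3 h4 h5 h6
  simp only [ascPochhammer_succ_eval, ascPochhammer_zero, Polynomial.eval_one, norm_mul,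
    one_mul, Nat.cast_zero, add_zero, Nat.cast_one, Nat.cast_ofNat]
  calc _ ≤ ((7.02 + 1) * (7.16 + 1) * (7.44 + 1) * (7.83 + 1) * (8.33 + 1) * (8.91 + 1) *
      (9.56 + 1) : ℝ) := by gcongr
    _ ≤ 4800000 := by norm_num

theorem deriv_riemannZeta_ne_zero_of_mem_Icc {t : ℝ} (ht : t ∈ Icc (11 / 2 : ℝ) 7) :
    deriv riemannZeta (1 / 2 + t * I) ≠ 0 := by
  obtain ⟨ht1, ht2⟩ := ht
  intro h0
  set s : ℂ := 1 / 2 + t * I with hs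
  have hball : ∀ z ∈ Metric.closedBall s 1, ‖z - s‖ ≤ 1 ∧ -(1 / 2) ≤ z.re ∧ 4 < z.im := by
    intro z hz
    rw [mem_closedBall_iff_norm] at hz
    have h1 := (abs_le.mp ((abs_re_le_norm _).trans hz)).1
    have h2 := (abs_le.mp ((abs_im_le_norm _).trans hz)).1
    simp [hs] at h1 h2
    exact ⟨hz, by linarith, by linarith⟩
  have hne : ∀ z ∈ Metric.closedBall s 1, z ≠ 1 := by
    rintro z hz rfl
    have := (hball _ hz).2.2
    norm_num at this
  have hlog : Complex.log 2 = (Real.log 2 : ℝ) := by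
    rw [ofReal_log (by norm_num)]; norm_num
  set E : ℂ → ℂ := fun z => 2 ^ z * (riemannZeta z - 1) - zetaMain z with hE
  have hEd : ∀ z ∈ Metric.closedBall s 1, HasDerivAt E (2 ^ z * Real.log 2 * (riemannZeta z - 1) +
      2 ^ z * deriv riemannZeta z - zetaMainDeriv z) z := fun z hz => by
    have h1 := ((hasDerivAt_id z).const_cpow (c := 2) (Or.inl two_ne_zero)).mul
      ((differentiableAt_riemannZeta (hne z hz)).hasDerivAt.sub_const 1)
    have h2 := h1.sub (hasDerivAt_zetaMain (hne z hz))
    rw [hlog] at h2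
    refine h2.congr_deriv ?_
    simp
  have hEb : ∀ z ∈ Metric.closedBall s 1, ‖E z‖ ≤ 0.0902 := fun z hz => by
    obtain ⟨h1, h2, h3⟩ := hball z hz
    refine (norm_two_cpow_mul_riemannZeta_sub_le (by linarith) (by linarith)).trans ?_
    have := norm_ascPochhammer_seven_le (by linarith) ht2 h1
    rw [div_le_iff₀ (by linarith)]
    linarith
  have hsm : s ∈ Metric.closedBall s 1 := Metric.mem_closedBall_self zero_le_one
  have hE' : ‖deriv E s‖ ≤ 0.0902 := by
    have := norm_deriv_le_of_forall_mem_sphere_norm_le (f := E) (c := s) zero_lt_one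
      (DifferentiableOn.diffContOnCl fun z hz => ?_)
      fun z hz => hEb z (Metric.sphere_subset_closedBall hz)
    · simpa using this
    · rw [closure_ball _ one_ne_zero] at hz
      exact (hEd z hz).differentiableAt.differentiableWithinAt
  have key : zetaMainDeriv s - Real.log 2 * zetaMain s = Real.log 2 * E s - deriv E s := by
    rw [(hEd s hsm).deriv, h0, hE]
    ring
  have hl1 := Real.log_two_gt_d9
  have hl2 := Real.log_two_lt_d9
  have hre := re_zetaMainDeriv_sub_le ht1 ht2 (l := Real.log 2) (by linarith)
  rw [← hs, key] at hre
  have h1 : ‖Real.log 2 * E s - deriv E s‖ ≤ 0.7 * 0.0902 + 0.0902 := by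
    refine (norm_sub_le _ _).trans (add_le_add ?_ hE')
    rw [norm_mul, norm_real, Real.norm_of_nonneg (by linarith)]
    have := hEb s hsm
    gcongr
    linarith
  have h2 := (abs_le.mp ((abs_re_le_norm _).trans h1)).1
  linarith

theorem exists_tendsto_natCast_cpow_mul_I : ∃ T : ℕ → ℕ, (∀ j, 1 ≤ T j) ∧
    ∀ n : ℕ, Tendsto (fun j => ((n + 1 : ℂ) ^ (T j * I))⁻¹) atTop (𝓝 1) := by
  obtain ⟨a, u, hu, hlim⟩ := CompactSpace.tendsto_subseq
    (fun k : ℕ => fun n : ℕ => Circle.exp (-(k * Real.log (n + 1))))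
  refine ⟨fun j => u (j + 1) - u j, fun j => Nat.le_sub_of_add_le' (hu (Nat.lt_succ_self j)),
    fun n => ?_⟩
  have h1 := tendsto_pi_nhds.mp hlim n
  have h2 := (h1.comp (tendsto_add_atTop_nat 1)).mul h1.inv
  rw [mul_inv_cancel] at h2
  have h3 := (continuous_subtype_val.tendsto (1 : Circle)).comp h2
  refine h3.congr fun j => ?_
  have hle : u j ≤ u (j + 1) := (hu (Nat.lt_succ_self j)).le
  have hn : (n + 1 : ℂ) ≠ 0 := Nat.cast_add_one_ne_zero n
  have hlog : Complex.log (n + 1) = (Real.log (n + 1) : ℝ) := by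
    rw [ofReal_log (by positivity)]; push_cast; rfl
  simp only [Function.comp, Circle.coe_mul, Circle.coe_inv, Circle.coe_exp]
  rw [cpow_def_of_ne_zero hn, ← Complex.exp_neg, ← Complex.exp_neg, ← Complex.exp_add, hlog]
  congr 1
  push_cast [Nat.cast_sub hle]
  ring

theorem exists_tendsto_riemannZeta_add_mul_I : ∃ T : ℕ → ℕ, (∀ j, 1 ≤ T j) ∧
    ∀ s : ℂ, 1 < s.re → Tendsto (fun j => riemannZeta (s + T j * I)) atTop (𝓝 (riemannZeta s)) := by
  obtain ⟨T, hT1, hT⟩ := exists_tendsto_natCast_cpow_mul_I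
  refine ⟨T, hT1, fun s hs => ?_⟩
  have h0 : ∀ j, 1 < (s + T j * I).re := fun j => by simpa using hs
  simp only [zeta_eq_tsum_one_div_nat_add_one_cpow (h0 _),
    zeta_eq_tsum_one_div_nat_add_one_cpow hs]
  refine tendsto_tsum_of_dominated_convergence (bound := fun n : ℕ => ‖1 / (n + 1 : ℂ) ^ s‖)
    ?_ (fun n => ?_) (Eventually.of_forall fun j n => ?_)
  · have := ((summable_nat_add_iff 1).mpr (Complex.summable_one_div_nat_cpow.mpr hs)).norm
    exact_mod_cast this
  · have hn : (n + 1 : ℂ) ≠ 0 := Nat.cast_add_one_ne_zero n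
    have := (hT n).const_mul (1 / (n + 1 : ℂ) ^ s)
    rw [mul_one] at this
    refine this.congr fun j => ?_
    rw [cpow_add _ _ hn, one_div, one_div, mul_inv]
  · rw [norm_div, norm_div]
    have : (0 : ℝ) < n + 1 := by positivity
    have h1 := norm_cpow_eq_rpow_re_of_pos this s
    have h2 := norm_cpow_eq_rpow_re_of_pos this (s + T j * I)
    push_cast at h1 h2
    rw [h1, h2]
    simp

theorem not_bounded_riemannZeta {C : ℝ}
    (h : ∀ s : ℂ, 1 < s.re → s.re < 3 / 2 → 1 ≤ s.im → ‖riemannZeta s‖ ≤ C) : False := by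
  obtain ⟨T, hT1, hT⟩ := exists_tendsto_riemannZeta_add_mul_I
  have h1 : ∀ s : ℂ, 1 < s.re → s.re < 3 / 2 → s.im = 0 → ‖riemannZeta s‖ ≤ C :=
    fun s hs hs' hs0 => le_of_tendsto (hT s hs).norm (Eventually.of_forall fun j => by
      refine h _ (by simpa using hs) (by simpa using hs') ?_
      simpa [hs0] using hT1 j)
  have h2 : Tendsto (fun x : ℝ => (1 + x : ℂ)) (𝓝[>] 0) (𝓝[≠] 1) := by
    refine tendsto_nhdsWithin_iff.mpr ⟨?_, ?_⟩
    · have : Continuous fun x : ℝ => (1 + x : ℂ) := by fun_prop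
      simpa using (this.tendsto 0).mono_left nhdsWithin_le_nhds
    · filter_upwards [self_mem_nhdsWithin] with x hx
      simpa using (ne_of_gt hx : x ≠ 0)
  have h3 := (riemannZeta_residue_one.comp h2).norm
  have h4 : Tendsto (fun x : ℝ => x * C) (𝓝[>] 0) (𝓝 0) := by
    have : Continuous fun x : ℝ => x * C := by fun_prop
    simpa using (this.tendsto 0).mono_left nhdsWithin_le_nhds
  have h5 : ∀ᶠ x : ℝ in 𝓝[>] 0, x < 1 / 2 :=
    nhdsWithin_le_nhds (gt_mem_nhds (by norm_num))
  have := le_of_tendsto_of_tendsto h3 h4 (by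
    filter_upwards [self_mem_nhdsWithin, h5] with x (hx : 0 < x) hx'
    have := h1 (1 + x) (by simpa using hx) (by simp; linarith) (by simp)
    simp only [Function.comp, add_sub_cancel_left, norm_mul, norm_real, Real.norm_of_nonneg hx.le]
    gcongr)
  norm_num at this

theorem norm_riemannZeta_le_of_one_half_le : ∃ A : ℝ, 0 ≤ A ∧ ∀ s : ℂ, 1 / 2 ≤ s.re →
    s.re ≤ 3 / 2 → 1 ≤ |s.im| → ‖riemannZeta s‖ ≤ A * (3 + |s.im|) ^ 2 := by
  obtain ⟨K, hK⟩ := isCompact_Icc.exists_bound_of_continuousOn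
    ((continuous_bernoulliFun (k := 2)).continuousOn (s := Icc (0 : ℝ) 1))
  have hK0 : 0 ≤ K := (norm_nonneg _).trans (hK 0 (by simp))
  have key : ∀ s : ℂ, 1 / 2 ≤ s.re → s.re ≤ 3 / 2 → 1 ≤ s.im →
      ‖riemannZeta s‖ ≤ (1 + K) * (3 + |s.im|) ^ 2 := by
    intro s h1 h2 h3
    have h := norm_riemannZeta_sub_le (m := 2) le_rfl 0 (s := s) (by norm_num; linarith)
      (by linarith) (K := K) hK
    rw [abs_of_nonneg (by linarith)]
    simp [ascPochhammer_succ_eval, zetaTail, Finset.sum_range_succ, bernoulliFun_eval_one,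
      bernoulliFun_eval_zero, bernoulli_one, bernoulli_two] at h
    have hs : ‖s‖ ≤ 2 + s.im := (norm_le_abs_re_add_abs_im s).trans (by
      rw [abs_of_nonneg (by linarith), abs_of_nonneg (by linarith)]; linarith)
    have hs1 : ‖s + 1‖ ≤ 3 + s.im := (norm_add_le _ _).trans (by rw [norm_one]; linarith)
    have hi : ‖(s - 1)⁻¹‖ ≤ 1 := by
      rw [norm_inv]
      refine inv_le_one_of_one_le₀ (h3.trans ((le_abs_self _).trans ?_))
      simpa using abs_im_le_norm (s - 1)
    have hmain : ‖(s - 1)⁻¹ + (-1 / 2 + 1 + 6⁻¹ / 2 * s)‖ ≤ 1 + (1 / 2 + 1 / 12 * (2 + s.im)) := by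
      refine (norm_add_le _ _).trans (add_le_add hi ((norm_add_le _ _).trans (add_le_add ?_ ?_)))
      · norm_num
      · rw [norm_mul]
        have : ‖(6⁻¹ / 2 : ℂ)‖ = 1 / 12 := by norm_num
        rw [this]
        gcongr
    have herr : K / 2 * (‖s‖ * ‖s + 1‖) * (s.re + 2 - 1)⁻¹ ≤
        K / 2 * ((2 + s.im) * (3 + s.im)) * 1 := by
      have h0 : (0 : ℝ) ≤ (s.re + 2 - 1)⁻¹ := inv_nonneg.mpr (by linarith)
      refine mul_le_mul ?_ (inv_le_one_of_one_le₀ (by linarith)) h0 (by positivity)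
      gcongr
    have hz := norm_le_norm_sub_add (riemannZeta s) ((s - 1)⁻¹ + (-1 / 2 + 1 + 6⁻¹ / 2 * s))
    have h5 : K * ((2 + s.im) * (3 + s.im)) ≤ K * (3 + s.im) ^ 2 := by
      gcongr
      nlinarith
    have h6 : 0 ≤ K * (3 + s.im) ^ 2 := by positivity
    nlinarith
  refine ⟨1 + K, by positivity, fun s h1 h2 h3 => ?_⟩
  rcases le_total 0 s.im with h4 | h4
  · exact key s h1 h2 (by rwa [abs_of_nonneg h4] at h3)
  · have := key ((starRingEnd ℂ) s) (by rwa [conj_re]) (by rwa [conj_re])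
      (by rw [abs_of_nonpos h4] at h3; simpa using h3)
    rwa [riemannZeta_conj, norm_conj, conj_im, abs_neg] at this

theorem differentiable_update_sub_one_mul_riemannZeta :
    Differentiable ℂ (Function.update (fun s => (s - 1) * riemannZeta s) 1 1) := by
  have h1 : ∀ s : ℂ, s ≠ 1 →
      DifferentiableAt ℂ (Function.update (fun s => (s - 1) * riemannZeta s) 1 1) s := by
    intro s hs
    have : DifferentiableAt ℂ (fun s => (s - 1) * riemannZeta s) s :=
      (differentiableAt_id.sub_const 1).mul (differentiableAt_riemannZeta hs)
    refine this.congr_of_eventuallyEq ?_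
    filter_upwards [isOpen_ne.mem_nhds hs] with z hz
    rw [Function.update_of_ne hz]
  intro s
  rcases eq_or_ne s 1 with rfl | hs
  · refine (Complex.analyticAt_of_differentiable_on_punctured_nhds_of_continuousAt ?_
      ?_).differentiableAt
    · filter_upwards [self_mem_nhdsWithin] with z hz using h1 z hz
    · rw [continuousAt_update_same]
      exact riemannZeta_residue_one
  · exact h1 s hs

theorem norm_riemannZeta_le_of_bounded_critical_line {M : ℝ}
    (hM : ∀ s : ℂ, s.re = 1 / 2 → ‖riemannZeta s‖ ≤ M) :
    ∃ C, ∀ s : ℂ, 1 / 2 ≤ s.re → s.re ≤ 3 / 2 → 1 ≤ |s.im| → ‖riemannZeta s‖ ≤ C := by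
  obtain ⟨A, hA0, hA⟩ := norm_riemannZeta_le_of_one_half_le
  set G : ℂ → ℂ := Function.update (fun s => (s - 1) * riemannZeta s) 1 1 with hG
  set f : ℂ → ℂ := fun s => G s / (s + 1) with hf
  have hne : ∀ s : ℂ, 1 / 2 ≤ s.re → s + 1 ≠ 0 := fun s hs h0 => by
    have := congrArg re h0
    simp at this
    linarith
  have hfz : ∀ s : ℂ, s ≠ 1 → f s = (s - 1) / (s + 1) * riemannZeta s := fun s hs => by
    rw [hf, hG]
    simp only [Function.update_of_ne hs]
    ring
  have hle : ∀ s : ℂ, 1 / 2 ≤ s.re → s ≠ 1 → ‖f s‖ ≤ ‖riemannZeta s‖ := fun s hs hs1 => by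
    rw [hfz s hs1, norm_mul]
    refine mul_le_of_le_one_left (norm_nonneg _) ?_
    rw [norm_div, div_le_one (norm_pos_iff.mpr (hne s hs)), ← sq_le_sq₀ (norm_nonneg _)
      (norm_nonneg _), Complex.sq_norm, Complex.sq_norm, normSq_apply, normSq_apply]
    simp
    nlinarith
  have hC0 : ∀ s : ℂ, s.re = 3 / 2 → ‖riemannZeta s‖ ≤ ∑' n : ℕ, 1 / (n + 1 : ℝ) ^ (3 / 2 : ℝ) :=
    fun s hs => by
    have hs1 : 1 < s.re := by rw [hs]; norm_num
    have e : ∀ n : ℕ, ‖1 / (n + 1 : ℂ) ^ s‖ = 1 / (n + 1 : ℝ) ^ (3 / 2 : ℝ) := fun n => by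
      have h1 := norm_cpow_eq_rpow_re_of_pos (by positivity : (0 : ℝ) < n + 1) s
      push_cast at h1
      rw [norm_div, h1, hs, norm_one]
    rw [zeta_eq_tsum_one_div_nat_add_one_cpow hs1]
    refine (norm_tsum_le_tsum_norm ?_).trans (le_of_eq (tsum_congr e))
    have := ((summable_nat_add_iff 1).mpr (Complex.summable_one_div_nat_cpow.mpr hs1)).norm
    exact_mod_cast this
  set C0 := ∑' n : ℕ, 1 / (n + 1 : ℝ) ^ (3 / 2 : ℝ)
  have hPL : ∀ s : ℂ, 1 / 2 ≤ s.re → s.re ≤ 3 / 2 → ‖f s‖ ≤ max M C0 := fun s hs hs' => by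
    refine PhragmenLindelof.vertical_strip (a := 1 / 2) (b := 3 / 2) ?_ ?_ ?_ ?_ hs hs'
    · refine DifferentiableOn.diffContOnCl fun z hz => ?_
      have hz' : 1 / 2 ≤ z.re := by
        have h1 : closure (re ⁻¹' Ioo (1 / 2 : ℝ) (3 / 2)) ⊆ re ⁻¹' Icc (1 / 2) (3 / 2) :=
          closure_minimal (preimage_mono Ioo_subset_Icc_self)
            (isClosed_Icc.preimage continuous_re)
        exact (h1 hz).1
      exact ((differentiable_update_sub_one_mul_riemannZeta z).div (by fun_prop)
        (hne z hz')).differentiableWithinAt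
    · refine ⟨1, by norm_num; linarith [Real.pi_gt_three], 4, ?_⟩
      refine Asymptotics.IsBigO.of_bound A ?_
      have h1 : ∀ᶠ z : ℂ in comap (_root_.abs ∘ im) atTop, 1 ≤ |z.im| :=
        (tendsto_comap (f := _root_.abs ∘ im)).eventually (eventually_ge_atTop 1)
      filter_upwards [h1.filter_mono inf_le_left, mem_inf_of_right (mem_principal_self _)]
        with z hz1 hz2
      have hz0 : z ≠ 1 := by
        rintro rfl
        norm_num at hz1
      have hz2' : z.re ∈ Ioo (1 / 2 : ℝ) (3 / 2) := hz2
      refine (hle z hz2'.1.le hz0).trans ((hA z hz2'.1.le hz2'.2.le hz1).trans ?_)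
      rw [Real.norm_of_nonneg (Real.exp_pos _).le]
      gcongr
      have e1 := Real.add_one_le_exp (2 + |z.im|)
      have e2 := Real.add_one_le_exp (1 * |z.im|)
      calc (3 + |z.im|) ^ 2 ≤ (Real.exp (2 + |z.im|)) ^ 2 := by
            gcongr; linarith
        _ = Real.exp (2 * (2 + |z.im|)) := by rw [← Real.exp_nat_mul]; norm_num
        _ ≤ _ := by
          apply Real.exp_le_exp.mpr
          linarith [abs_nonneg z.im]
    · intro z hz
      have hz0 : z ≠ 1 := by
        rintro rfl
        norm_num at hz
      exact (hle z hz.ge hz0).trans ((hM z hz).trans (le_max_left _ _))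
    · intro z hz
      have hz0 : z ≠ 1 := by
        rintro rfl
        norm_num at hz
      exact (hle z (by linarith) hz0).trans ((hC0 z hz).trans (le_max_right _ _))
  refine ⟨3 * max M C0, fun s hs hs' him => ?_⟩
  have hs1 : s ≠ 1 := by
    rintro rfl
    norm_num at him
  have hsub : 1 ≤ ‖s - 1‖ := by
    refine him.trans ?_
    simpa using abs_im_le_norm (s - 1)
  have e1 : riemannZeta s = (s + 1) / (s - 1) * f s := by
    rw [hfz s hs1]
    have := sub_ne_zero.mpr hs1
    have := hne s hs
    field_simp
  have e2 : ‖s + 1‖ ≤ ‖s - 1‖ + 2 := by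
    have := norm_add_le (s - 1) 2
    rw [show s - 1 + 2 = s + 1 by ring] at this
    simpa using this
  have e3 : ‖(s + 1) / (s - 1)‖ ≤ 3 := by
    rw [norm_div, div_le_iff₀ (by linarith)]
    linarith
  rw [e1, norm_mul]
  have := hPL s hs hs'
  gcongr

theorem exists_lt_norm_riemannZeta_critical_line (C : ℝ) :
    ∃ s : ℂ, s.re = 1 / 2 ∧ C < ‖riemannZeta s‖ := by
  by_contra! hM
  obtain ⟨C', hC'⟩ := norm_riemannZeta_le_of_bounded_critical_line hM
  exact not_bounded_riemannZeta fun s h1 h2 h3 =>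
    hC' s (by linarith) h2.le (h3.trans (le_abs_self _))

theorem exists_nonneg_lt_norm_riemannZeta (C : ℝ) :
    ∃ t : ℝ, 0 ≤ t ∧ C < ‖riemannZeta (1 / 2 + t * I)‖ ∧ C < ‖riemannZeta (1 / 2 - t * I)‖ := by
  obtain ⟨s, hs, hC⟩ := exists_lt_norm_riemannZeta_critical_line C
  have hconj : ∀ t : ℝ, ‖riemannZeta (1 / 2 - t * I)‖ = ‖riemannZeta (1 / 2 + t * I)‖ := fun t => by
    rw [← norm_conj, ← riemannZeta_conj]
    congr 2
    simp [sub_neg_eq_add, Complex.conj_ofNat]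
  have hs' : s = 1 / 2 + s.im * I := by
    apply Complex.ext <;> simp [hs]
  rcases le_total 0 s.im with h | h
  · refine ⟨s.im, h, ?_⟩
    rw [hconj, ← hs']
    exact ⟨hC, hC⟩
  · refine ⟨-s.im, by linarith, ?_⟩
    rw [← hconj]
    push_cast
    rw [neg_mul, sub_neg_eq_add, ← hs']
    exact ⟨hC, hC⟩

end

section

open Filter Topology Set
open scoped Real

theorem le_hasDerivAt_of_tendsto_of_le {f f' : ℕ → ℝ → ℝ} {g : ℝ → ℝ} {g' a b L : ℝ} (hab : a < b)
    (hf : ∀ᶠ n in atTop, ∀ x ∈ Icc a b, HasDerivAt (f n) (f' n x) x)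
    (hlim : ∀ x ∈ Icc a b, Tendsto (fun n => f n x) atTop (𝓝 (g x))) (hg : HasDerivAt g g' a)
    (hL : ∀ᶠ n in atTop, ∀ x ∈ Icc a b, L ≤ f' n x) : L ≤ g' := by
  have hslope : Tendsto (slope g a) (𝓝[>] a) (𝓝 g') :=
    (hasDerivAt_iff_tendsto_slope.mp hg).mono_left (nhdsWithin_mono a fun x hx => ne_of_gt hx)
  refine ge_of_tendsto hslope ?_
  filter_upwards [Ioc_mem_nhdsGT hab] with x hx
  have hx0 : 0 < x - a := sub_pos.mpr hx.1
  have hxI : x ∈ Icc a b := ⟨hx.1.le, hx.2⟩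
  have haI : a ∈ Icc a b := ⟨le_rfl, hab.le⟩
  rw [slope_def_field, le_div_iff₀ hx0]
  refine ge_of_tendsto ((hlim x hxI).sub (hlim a haI)) ?_
  filter_upwards [hf, hL] with n hfn hLn
  refine (convex_Icc a b).mul_sub_le_image_sub_of_le_deriv
    (fun z hz => (hfn z hz).continuousAt.continuousWithinAt)
    (fun z hz => (hfn z (interior_subset hz)).differentiableAt.differentiableWithinAt)
    (fun z hz => ?_) a haI x hxI hx.1.le
  rw [(hfn z (interior_subset hz)).deriv]
  exact hLn z (interior_subset hz)

/-- The logarithm of `‖Complex.GammaSeq (x + y * I) n‖`. -/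
noncomputable def logNormGammaSeq (y : ℝ) (n : ℕ) (x : ℝ) : ℝ :=
  x * Real.log n + Real.log n.factorial -
    ∑ k ∈ Finset.range (n + 1), Real.log ((x + k) ^ 2 + y ^ 2) / 2

/-- The derivative of `logNormGammaSeq y n`, with `log n` replaced by `log (n + c)`. -/
noncomputable def reDigammaSeq (c : ℕ) (y : ℝ) (n : ℕ) (x : ℝ) : ℝ :=
  Real.log ((n : ℝ) + c) - ∑ k ∈ Finset.range (n + 1), (x + k) / ((x + k) ^ 2 + y ^ 2)

theorem logNormGammaSeq_eq {x : ℝ} (hx : 0 < x) (y : ℝ) {n : ℕ} (hn : 0 < n) :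
    logNormGammaSeq y n x = Real.log ‖GammaSeq (x + y * I) n‖ := by
  have hn' : (0 : ℝ) < n := by exact_mod_cast hn
  have hk : ∀ k : ℕ, ‖(x + y * I + k : ℂ)‖ = √((x + k) ^ 2 + y ^ 2) := fun k => by
    rw [Complex.norm_def, normSq_apply]
    congr 1
    simp
    ring
  have hpos : ∀ k : ℕ, 0 < (x + k) ^ 2 + y ^ 2 := fun k => by positivity
  rw [GammaSeq, norm_div, norm_mul, norm_prod, ← ofReal_natCast n,
    norm_cpow_eq_rpow_re_of_pos hn', norm_natCast, Real.log_div, Real.log_mul, Real.log_rpow hn',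
    Real.log_prod]
  · simp only [hk, Real.log_sqrt (hpos _).le]
    simp [logNormGammaSeq]
  · intro k _
    rw [hk]
    exact (Real.sqrt_pos.mpr (hpos k)).ne'
  · positivity
  · positivity
  · positivity
  · refine Finset.prod_ne_zero_iff.mpr fun k _ => ?_
    rw [hk]
    exact (Real.sqrt_pos.mpr (hpos k)).ne'

theorem tendsto_logNormGammaSeq {x : ℝ} (hx : 0 < x) (y : ℝ) :
    Tendsto (fun n => logNormGammaSeq y n x) atTop (𝓝 (Real.log ‖Gamma (x + y * I)‖)) := by
  have hΓ : Gamma (x + y * I) ≠ 0 := Gamma_ne_zero_of_re_pos (by simpa using hx)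
  refine ((GammaSeq_tendsto_Gamma (x + y * I)).norm.log (norm_ne_zero_iff.mpr hΓ)).congr' ?_
  filter_upwards [eventually_gt_atTop 0] with n hn
  rw [logNormGammaSeq_eq hx y hn]

theorem hasDerivAt_logNormGammaSeq {x : ℝ} (hx : 0 < x) (y : ℝ) (n : ℕ) :
    HasDerivAt (logNormGammaSeq y n) (reDigammaSeq 0 y n x) x := by
  have h1 : ∀ k : ℕ, HasDerivAt (fun x : ℝ => Real.log ((x + k) ^ 2 + y ^ 2) / 2)
      ((x + k) / ((x + k) ^ 2 + y ^ 2)) x := fun k => by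
    have hpos : 0 < (x + k) ^ 2 + y ^ 2 := by positivity
    refine HasDerivAt.congr_deriv ((((((hasDerivAt_id x).add_const (k : ℝ)).pow 2).add_const
      (y ^ 2)).log hpos.ne').div_const 2) ?_
    simp
    field_simp
  refine HasDerivAt.congr_deriv ((((hasDerivAt_id x).mul_const (Real.log n)).add_const
    (Real.log n.factorial)).sub (HasDerivAt.fun_sum fun k _ => h1 k)) ?_
  simp [reDigammaSeq]

theorem hasDerivAt_log_norm_Gamma {x : ℝ} (hx : 0 < x) (y : ℝ) :
    HasDerivAt (fun x : ℝ => Real.log ‖Gamma (x + y * I)‖) (digamma (x + y * I)).re x := by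
  have hre : 0 < (x + y * I : ℂ).re := by simpa using hx
  have hΓ : Gamma (x + y * I) ≠ 0 := Gamma_ne_zero_of_re_pos hre
  have hd : HasDerivAt (fun x : ℝ => Gamma (x + y * I)) (deriv Gamma (x + y * I)) x := by
    have h0 : HasDerivAt Gamma (deriv Gamma (x + y * I)) (x + y * I) :=
      (differentiableAt_Gamma _ fun m hm => by
        rw [hm] at hre
        simp at hre
        linarith [(Nat.cast_nonneg m : (0 : ℝ) ≤ m)]).hasDerivAt
    exact (h0.comp_add_const (x : ℂ) (y * I)).comp_ofReal
  have hn : HasDerivAt (fun x : ℝ => ‖Gamma (x + y * I)‖ ^ 2) _ x := hd.norm_sq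
  refine (HasDerivAt.congr_deriv ((hn.log (by positivity)).div_const 2) ?_).congr_of_eventuallyEq
    (Eventually.of_forall fun z => ?_)
  · rw [digamma_def, logDeriv_apply, Complex.inner, ← normSq_eq_norm_sq, div_re, mul_re, conj_re,
      conj_im]
    have : normSq (Gamma (x + y * I)) ≠ 0 := normSq_eq_zero.not.mpr hΓ
    field_simp
    ring
  · simp only [Real.log_pow]
    push_cast
    ring

theorem monotoneOn_reDigammaSeq_zero {x : ℝ} (hx : 0 ≤ x) (y : ℝ) {m n : ℕ} (hm : 0 < m)
    (hmn : m ≤ n) : reDigammaSeq 0 y m x ≤ reDigammaSeq 0 y n x := by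
  induction n, hmn using Nat.le_induction with
  | base => rfl
  | succ n hn ih =>
    refine ih.trans ?_
    have hn0 : (0 : ℝ) < n := by exact_mod_cast hm.trans_le hn
    simp only [reDigammaSeq]
    rw [Finset.sum_range_succ _ (n + 1)]
    have h1 : (x + (n + 1 : ℕ)) / ((x + (n + 1 : ℕ)) ^ 2 + y ^ 2) ≤ 1 / (n + 1) := by
      push_cast
      rw [div_le_div_iff₀ (by positivity) (by positivity)]
      nlinarith [sq_nonneg y]
    have h2 : 1 / (n + 1 : ℝ) ≤ Real.log (n + 1) - Real.log n := by
      have := Real.one_sub_inv_le_log_of_pos (x := (n + 1 : ℝ) / n) (by positivity)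
      rw [Real.log_div (by positivity) (by positivity)] at this
      refine le_trans (le_of_eq ?_) this
      field_simp
      ring
    push_cast at *
    simp only [add_zero] at *
    linarith

theorem reDigammaSeq_two_le {x y : ℝ} (hx : 0 ≤ x) (hx' : x ≤ 3 / 10) (hy : y ^ 2 ≤ (11 / 4) ^ 2)
    {m n : ℕ} (hm : 10 ≤ m) (hmn : m ≤ n) : reDigammaSeq 2 y n x ≤ reDigammaSeq 2 y m x := by
  induction n, hmn using Nat.le_induction with
  | base => rfl
  | succ n hn ih =>
    refine le_trans ?_ ih
    have hn0 : (10 : ℝ) ≤ n := by exact_mod_cast hm.trans hn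
    simp only [reDigammaSeq]
    rw [Finset.sum_range_succ _ (n + 1)]
    have h1 : 1 / (n + 2 : ℝ) ≤ (x + (n + 1 : ℕ)) / ((x + (n + 1 : ℕ)) ^ 2 + y ^ 2) := by
      push_cast
      rw [div_le_div_iff₀ (by positivity) (by positivity)]
      nlinarith
    have h2 : Real.log (n + 1 + 2) - Real.log (n + 2) ≤ 1 / (n + 2 : ℝ) := by
      have := Real.log_le_sub_one_of_pos (x := (n + 1 + 2 : ℝ) / (n + 2)) (by positivity)
      rw [Real.log_div (by positivity) (by positivity)] at this
      refine this.trans (le_of_eq ?_)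
      field_simp
      ring
    push_cast at *
    linarith

theorem reDigammaSeq_zero_le_two {x y : ℝ} {n : ℕ} (hn : 0 < n) :
    reDigammaSeq 0 y n x ≤ reDigammaSeq 2 y n x := by
  have hn0 : (0 : ℝ) < n := by exact_mod_cast hn
  simp only [reDigammaSeq]
  gcongr
  norm_num

theorem continuousAt_reDigammaSeq (c : ℕ) (y : ℝ) (n : ℕ) {x : ℝ} (hx : 0 < x) :
    ContinuousAt (reDigammaSeq c y n) x := by
  unfold reDigammaSeq
  refine continuousAt_const.sub (tendsto_finsetSum _ fun k _ => ?_)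
  have hpos : 0 < (x + k) ^ 2 + y ^ 2 := by positivity
  exact ContinuousAt.div (by fun_prop) (by fun_prop) hpos.ne'

theorem log_pi_lt_reDigammaSeq {y : ℝ} (hy : (7 / 2) ^ 2 ≤ y ^ 2) :
    Real.log π < reDigammaSeq 0 y 15 (1 / 4) := by
  have h1 : ∑ k ∈ Finset.range (15 + 1), ((1 / 4 : ℝ) + k) / ((1 / 4 + k) ^ 2 + y ^ 2) ≤
      ∑ k ∈ Finset.range (15 + 1), ((1 / 4 : ℝ) + k) / ((1 / 4 + k) ^ 2 + (7 / 2) ^ 2) := by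
    gcongr
  have h2 : ∑ k ∈ Finset.range (15 + 1), ((1 / 4 : ℝ) + k) / ((1 / 4 + k) ^ 2 + (7 / 2) ^ 2) ≤
      14 / 9 := by
    norm_num [Finset.sum_range_succ]
  have h3 : (14 / 9 : ℝ) < Real.log (477 / 100) := by
    rw [Real.lt_log_iff_exp_lt (by norm_num)]
    refine lt_of_pow_lt_pow_left₀ 9 (by norm_num) ?_
    rw [← Real.exp_nat_mul, show ((9 : ℕ) : ℝ) * (14 / 9) = (14 : ℕ) * 1 by norm_num,
      Real.exp_nat_mul]
    calc Real.exp 1 ^ 14 < (27183 / 10000) ^ 14 := by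
          gcongr
          exact Real.exp_one_lt_d9.trans (by norm_num)
      _ < (477 / 100) ^ 9 := by norm_num
  have h4 : Real.log (477 / 100) + Real.log π < Real.log 15 := by
    rw [← Real.log_mul (by positivity) (by positivity)]
    exact Real.log_lt_log (by positivity) (by linarith [Real.pi_lt_d6])
  simp only [reDigammaSeq]
  norm_num at *
  linarith

theorem reDigammaSeq_lt_log_pi {y : ℝ} (hy : y ^ 2 ≤ (11 / 4) ^ 2) :
    reDigammaSeq 2 y 10 (1 / 4) < Real.log π := by
  have h1 : ∑ k ∈ Finset.range (10 + 1), ((1 / 4 : ℝ) + k) / ((1 / 4 + k) ^ 2 + (11 / 4) ^ 2) ≤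
      ∑ k ∈ Finset.range (10 + 1), ((1 / 4 : ℝ) + k) / ((1 / 4 + k) ^ 2 + y ^ 2) := by
    gcongr
  have h2 : 11 / 8 ≤
      ∑ k ∈ Finset.range (10 + 1), ((1 / 4 : ℝ) + k) / ((1 / 4 + k) ^ 2 + (11 / 4) ^ 2) := by
    norm_num [Finset.sum_range_succ]
  have h3 : Real.log (382 / 100) < 11 / 8 := by
    rw [Real.log_lt_iff_lt_exp (by norm_num)]
    refine lt_of_pow_lt_pow_left₀ 8 (by positivity) ?_
    rw [← Real.exp_nat_mul, show ((8 : ℕ) : ℝ) * (11 / 8) = (11 : ℕ) * 1 by norm_num,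
      Real.exp_nat_mul]
    calc (382 / 100 : ℝ) ^ 8 < (27182 / 10000) ^ 11 := by norm_num
      _ < Real.exp 1 ^ 11 := by
          gcongr
          exact lt_trans (by norm_num) Real.exp_one_gt_d9
  have h4 : Real.log 12 < Real.log (382 / 100) + Real.log π := by
    rw [← Real.log_mul (by positivity) (by positivity)]
    exact Real.log_lt_log (by positivity) (by linarith [Real.pi_gt_d6])
  simp only [reDigammaSeq]
  norm_num at *
  linarith

theorem log_pi_lt_re_digamma {y : ℝ} (hy : (7 / 2) ^ 2 ≤ y ^ 2) :
    Real.log π < (digamma ((1 / 4 : ℝ) + y * I)).re := by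
  obtain ⟨L, hL, hL'⟩ := exists_between (log_pi_lt_reDigammaSeq hy)
  refine hL.trans_le ?_
  obtain ⟨b, hb, hb'⟩ := mem_nhdsGE_iff_exists_Icc_subset.mp (mem_nhdsWithin_of_mem_nhds
    ((continuousAt_reDigammaSeq 0 y 15 (by norm_num : (0 : ℝ) < 1 / 4)).eventually_const_lt hL'))
  have hpos : ∀ x ∈ Icc (1 / 4) b, (0 : ℝ) < x := fun x hx => by linarith [hx.1]
  refine le_hasDerivAt_of_tendsto_of_le hb
    (Eventually.of_forall fun n x hx => hasDerivAt_logNormGammaSeq (hpos x hx) y n)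
    (fun x hx => tendsto_logNormGammaSeq (hpos x hx) y)
    (hasDerivAt_log_norm_Gamma (by norm_num) y) ?_
  filter_upwards [eventually_ge_atTop 15] with n hn x hx
  exact (hb' hx).le.trans (monotoneOn_reDigammaSeq_zero (hpos x hx).le y (by norm_num) hn)

theorem re_digamma_lt_log_pi {y : ℝ} (hy : y ^ 2 ≤ (11 / 4) ^ 2) :
    (digamma ((1 / 4 : ℝ) + y * I)).re < Real.log π := by
  obtain ⟨L, hL, hL'⟩ := exists_between (reDigammaSeq_lt_log_pi hy)
  refine lt_of_le_of_lt ?_ hL'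
  obtain ⟨b, hb, hb'⟩ := mem_nhdsGE_iff_exists_Icc_subset.mp (mem_nhdsWithin_of_mem_nhds
    (((continuousAt_reDigammaSeq 2 y 10 (by norm_num : (0 : ℝ) < 1 / 4)).eventually_lt_const
      hL).and (Iic_mem_nhds (by norm_num : (1 / 4 : ℝ) < 3 / 10))))
  have hpos : ∀ x ∈ Icc (1 / 4) b, (0 : ℝ) < x := fun x hx => by linarith [hx.1]
  refine neg_le_neg_iff.mp (le_hasDerivAt_of_tendsto_of_le hb
    (Eventually.of_forall fun n x hx => (hasDerivAt_logNormGammaSeq (hpos x hx) y n).neg)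
    (fun x hx => (tendsto_logNormGammaSeq (hpos x hx) y).neg)
    (hasDerivAt_log_norm_Gamma (by norm_num) y).neg ?_)
  filter_upwards [eventually_ge_atTop 10] with n hn x hx
  refine neg_le_neg ((reDigammaSeq_zero_le_two (by omega)).trans ?_)
  exact (reDigammaSeq_two_le (hpos x hx).le (hb' hx).2 hy le_rfl hn).trans (hb' hx).1.le

/-- The factor in the functional equation `ζ (s) = χ (s) * ζ (1 - s)`. -/
noncomputable def zetaFactor (s : ℂ) : ℂ := Gammaℝ (1 - s) / Gammaℝ s

theorem analyticAt_Gammaℝ {s : ℂ} (hs : 0 < s.re) : AnalyticAt ℂ Gammaℝ s := by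
  have h : AnalyticAt ℂ (fun s => (Gammaℝ s)⁻¹) s := differentiable_Gammaℝ_inv.analyticAt s
  simpa [Pi.inv_def] using h.inv (inv_ne_zero (Gammaℝ_ne_zero_of_re_pos hs))

theorem analyticAt_zetaFactor {s : ℂ} (hs : 0 < s.re) (hs' : s.re < 1) :
    AnalyticAt ℂ zetaFactor s := by
  refine AnalyticAt.div ?_ (analyticAt_Gammaℝ hs) (Gammaℝ_ne_zero_of_re_pos hs)
  exact AnalyticAt.fun_comp (analyticAt_Gammaℝ (by simpa using hs')) (by fun_prop)

theorem riemannZeta_eq_zetaFactor_mul {s : ℂ} (hs : 0 < s.re) (hs' : s.re < 1) :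
    riemannZeta s = zetaFactor s * riemannZeta (1 - s) := by
  have h0 : s ≠ 0 := fun h => by simp [h] at hs
  have h1 : 1 - s ≠ 0 := fun h => by
    rw [← sub_eq_zero.mp h] at hs'
    simp at hs'
  have hre : 0 < (1 - s).re := by simpa using hs'
  rw [riemannZeta_def_of_ne_zero h0, riemannZeta_def_of_ne_zero h1, completedRiemannZeta_one_sub,
    zetaFactor]
  field_simp [Gammaℝ_ne_zero_of_re_pos hre]

theorem logDeriv_Gammaℝ {s : ℂ} (hs : 0 < s.re) :
    logDeriv Gammaℝ s = (digamma (s / 2) - Real.log π) / 2 := by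
  have hs2 : 0 < (s / 2).re := by
    rw [div_ofNat_re]; positivity
  have hΓ : DifferentiableAt ℂ Gamma (s / 2) := differentiableAt_Gamma _ fun m hm => by
    rw [hm] at hs2
    simp at hs2
    linarith [(Nat.cast_nonneg m : (0 : ℝ) ≤ m)]
  have hπ : (π : ℂ) ≠ 0 := by exact_mod_cast Real.pi_ne_zero
  have h1 : HasDerivAt (fun s : ℂ => (π : ℂ) ^ (-s / 2)) _ s :=
    ((hasDerivAt_id s).neg.div_const 2).const_cpow (Or.inl hπ)
  have h2 : HasDerivAt (fun s : ℂ => Gamma (s / 2)) _ s :=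
    HasDerivAt.comp s hΓ.hasDerivAt ((hasDerivAt_id s).div_const 2)
  have h3 : HasDerivAt Gammaℝ _ s := h1.mul h2
  rw [logDeriv_apply, h3.deriv, digamma_def, logDeriv_apply, Gammaℝ_def, ofReal_log Real.pi_pos.le]
  have h4 := Gamma_ne_zero_of_re_pos hs2
  have h5 : (π : ℂ) ^ (-s / 2) ≠ 0 := by simp [cpow_eq_zero_iff, hπ]
  simp
  field_simp
  ring

theorem deriv_zetaFactor_ne_zero {t : ℝ} (ht : t ∉ Ioo (11 / 2 : ℝ) 7)
    (ht' : -t ∉ Ioo (11 / 2 : ℝ) 7) : deriv zetaFactor (1 / 2 + t * I) ≠ 0 := by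
  set s : ℂ := 1 / 2 + t * I with hs
  have hre : s.re = 1 / 2 := by simp [hs]
  have hs0 : 0 < s.re := by rw [hre]; norm_num
  have hs1 : 0 < (1 - s).re := by rw [sub_re, one_re, hre]; norm_num
  have h0 := Gammaℝ_ne_zero_of_re_pos hs0
  have h1 := Gammaℝ_ne_zero_of_re_pos hs1
  have hd0 := (analyticAt_Gammaℝ hs0).differentiableAt
  have hd1 := (analyticAt_Gammaℝ hs1).differentiableAt
  have hd1' : HasDerivAt (fun z : ℂ => Gammaℝ (1 - z)) _ s :=
    HasDerivAt.comp s hd1.hasDerivAt ((hasDerivAt_id s).const_sub 1)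
  have hlog : logDeriv zetaFactor s = -logDeriv Gammaℝ (1 - s) - logDeriv Gammaℝ s := by
    have : logDeriv (fun z : ℂ => Gammaℝ (1 - z)) s = -logDeriv Gammaℝ (1 - s) := by
      rw [logDeriv_apply, hd1'.deriv, logDeriv_apply]
      ring
    rw [← this]
    exact logDeriv_div s h1 h0 hd1'.differentiableAt hd0
  have hsy : s / 2 = (1 / 4 : ℝ) + (t / 2 : ℝ) * I := by
    rw [hs]; push_cast; ring
  have hsy' : (1 - s) / 2 = (1 / 4 : ℝ) + (-(t / 2) : ℝ) * I := by
    rw [hs]; push_cast; ring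
  have hlogre : (logDeriv zetaFactor s).re = Real.log π - ((digamma (s / 2)).re +
      (digamma ((1 - s) / 2)).re) / 2 := by
    rw [hlog, logDeriv_Gammaℝ hs0, logDeriv_Gammaℝ hs1]
    simp only [sub_re, neg_re, div_ofNat_re, ofReal_re]
    ring
  intro hzero
  rw [logDeriv_apply, hzero, zero_div, zero_re] at hlogre
  have hcases : |t| ≤ 11 / 2 ∨ 7 ≤ |t| := by
    by_contra! h
    rcases abs_cases t with ⟨h2, -⟩ | ⟨h2, -⟩
    · exact ht ⟨h2 ▸ h.1, h2 ▸ h.2⟩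
    · exact ht' ⟨h2 ▸ h.1, h2 ▸ h.2⟩
  rw [hsy, hsy'] at hlogre
  rcases hcases with h | h
  · have h2 : (t / 2) ^ 2 ≤ (11 / 4) ^ 2 := by
      rw [sq_le_sq, abs_div, abs_two]; norm_num; linarith
    have := re_digamma_lt_log_pi h2
    have := re_digamma_lt_log_pi (y := -(t / 2)) (by rwa [neg_sq])
    linarith
  · have h2 : (7 / 2 : ℝ) ^ 2 ≤ (t / 2) ^ 2 := by
      rw [← sq_abs (t / 2), abs_div, abs_two]
      gcongr
    have := log_pi_lt_re_digamma h2
    have := log_pi_lt_re_digamma (y := -(t / 2)) (by rwa [neg_sq])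
    linarith

theorem deriv_riemannZeta_conj (s : ℂ) :
    deriv riemannZeta ((starRingEnd ℂ) s) = (starRingEnd ℂ) (deriv riemannZeta s) := by
  have h : (starRingEnd ℂ) ∘ riemannZeta ∘ (starRingEnd ℂ) = riemannZeta := by
    funext z
    simp [riemannZeta_conj]
  conv_lhs => rw [← h]
  rw [deriv_conj_conj]
  simp

theorem deriv_riemannZeta_or_zetaFactor_ne_zero (t : ℝ) :
    deriv riemannZeta (1 / 2 + t * I) ≠ 0 ∨ deriv zetaFactor (1 / 2 + t * I) ≠ 0 := by
  by_cases h1 : t ∈ Ioo (11 / 2 : ℝ) 7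
  · exact Or.inl (deriv_riemannZeta_ne_zero_of_mem_Icc (Ioo_subset_Icc_self h1))
  by_cases h2 : -t ∈ Ioo (11 / 2 : ℝ) 7
  · left
    have h := deriv_riemannZeta_ne_zero_of_mem_Icc (Ioo_subset_Icc_self h2)
    have hc : (1 / 2 + (-t : ℝ) * I : ℂ) = (starRingEnd ℂ) (1 / 2 + t * I) := by
      simp [Complex.conj_ofNat]
    rw [hc, deriv_riemannZeta_conj] at h
    exact fun h0 => h (by rw [h0, map_zero])
  · exact Or.inr (deriv_zetaFactor_ne_zero h1 h2)

theorem riemannZeta_one_sub_of_re_eq_one_half {s : ℂ} (hs : s.re = 1 / 2) :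
    riemannZeta (1 - s) = (starRingEnd ℂ) (riemannZeta s) := by
  rw [← riemannZeta_conj]
  congr 1
  apply Complex.ext
  · simp [hs]; norm_num
  · simp

theorem zetaFactor_eq_of_riemannZeta_eq {s z : ℂ} (hs : s.re = 1 / 2) (hz : z.re = 1 / 2)
    (h : riemannZeta s = riemannZeta z) (h0 : riemannZeta s ≠ 0) :
    zetaFactor s = zetaFactor z := by
  have hc : (starRingEnd ℂ) (riemannZeta s) ≠ 0 := (map_ne_zero _).mpr h0
  have h1 := riemannZeta_eq_zetaFactor_mul (s := s) (by rw [hs]; norm_num) (by rw [hs]; norm_num)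
  have h2 := riemannZeta_eq_zetaFactor_mul (s := z) (by rw [hz]; norm_num) (by rw [hz]; norm_num)
  rw [riemannZeta_one_sub_of_re_eq_one_half hs] at h1
  rw [riemannZeta_one_sub_of_re_eq_one_half hz, ← h] at h2
  exact mul_right_cancel₀ hc (h1.symm.trans h2)

theorem countable_riemannZetaZeros : riemannZetaZeros.Countable := by
  rw [← inter_univ riemannZetaZeros, ← Metric.iUnion_closedBall_nat (0 : ℂ), inter_iUnion]
  refine countable_iUnion fun n => ?_
  rw [inter_comm]
  exact (isCompact_closedBall (0 : ℂ) n).inter_riemannZetaZeros_finite.countable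

theorem countable_self_intersections_riemannZeta_zetaFactor :
    {p : ℝ × ℝ | p.1 ≠ p.2 ∧ riemannZeta (1 / 2 + p.1 * I) = riemannZeta (1 / 2 + p.2 * I) ∧
      zetaFactor (1 / 2 + p.1 * I) = zetaFactor (1 / 2 + p.2 * I)}.Countable := by
  have hline : ∀ z : ℂ, HasDerivAt (fun z : ℂ => 1 / 2 + z * I) I z := fun z => by
    simpa using ((hasDerivAt_id z).mul_const I).const_add (1 / 2)
  have hre : ∀ x : ℝ, (1 / 2 + x * I : ℂ).re = 1 / 2 := fun x => by simp
  have hζ : ∀ x : ℝ, AnalyticAt ℂ riemannZeta (1 / 2 + x * I) := fun x => by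
    have hopen : {z : ℂ | z ≠ 1} ∈ 𝓝 (1 / 2 + x * I : ℂ) := isOpen_ne.mem_nhds fun h => by
      have := hre x
      rw [h] at this
      norm_num at this
    exact DifferentiableOn.analyticAt
      (fun z hz => (differentiableAt_riemannZeta hz).differentiableWithinAt) hopen
  have hχ : ∀ x : ℝ, AnalyticAt ℂ zetaFactor (1 / 2 + x * I) := fun x =>
    analyticAt_zetaFactor (by rw [hre]; norm_num) (by rw [hre]; norm_num)
  have hd : ∀ {f : ℂ → ℂ} {x : ℝ}, AnalyticAt ℂ f (1 / 2 + x * I) →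
      deriv f (1 / 2 + x * I) ≠ 0 → deriv (fun z : ℂ => f (1 / 2 + z * I)) x ≠ 0 := by
    intro f x hf h
    have : HasDerivAt (fun z : ℂ => f (1 / 2 + z * I)) _ (x : ℂ) :=
      HasDerivAt.comp (x : ℂ) hf.differentiableAt.hasDerivAt (hline x)
    rw [this.deriv]
    exact mul_ne_zero h I_ne_zero
  refine countable_self_intersections_curve (g := fun z => riemannZeta (1 / 2 + z * I))
    (h := fun z => zetaFactor (1 / 2 + z * I))
    (fun x => AnalyticAt.fun_comp (hζ x) (by fun_prop))
    (fun x => AnalyticAt.fun_comp (hχ x) (by fun_prop))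
    (fun x => (deriv_riemannZeta_or_zetaFactor_ne_zero x).imp (hd (hζ x)) (hd (hχ x)))
    (fun C => ?_) (fun C => ?_)
  · obtain ⟨t, ht, h, -⟩ := exists_nonneg_lt_norm_riemannZeta C
    exact ⟨t, ht, h⟩
  · obtain ⟨t, ht, -, h⟩ := exists_nonneg_lt_norm_riemannZeta C
    refine ⟨-t, by linarith, ?_⟩
    simpa [sub_eq_add_neg] using h

end

theorem zeta_self_intersections_countable :
    Set.Countable {p : ℂ × ℂ | p.1.re = 1/2 ∧ p.2.re = 1/2 ∧ p.1 ≠ p.2 ∧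
      riemannZeta p.1 = riemannZeta p.2} := by
  refine ((countable_riemannZetaZeros.prod countable_riemannZetaZeros).union
    (countable_self_intersections_riemannZeta_zetaFactor.image
      fun p => (1 / 2 + p.1 * I, 1 / 2 + p.2 * I))).mono ?_
  rintro ⟨s, z⟩ ⟨hs, hz, hne, h⟩
  dsimp only at hs hz hne h
  by_cases h0 : riemannZeta s = 0
  · exact Or.inl ⟨h0, h.symm.trans h0⟩
  · have hs' : (1 / 2 + s.im * I : ℂ) = s := by apply Complex.ext <;> simp [hs]
    have hz' : (1 / 2 + z.im * I : ℂ) = z := by apply Complex.ext <;> simp [hz]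
    refine Or.inr ⟨(s.im, z.im), ⟨fun him => hne ?_, ?_, ?_⟩, ?_⟩
    · exact Complex.ext (hs.trans hz.symm) him
    · simpa only [hs', hz'] using h
    · simpa only [hs', hz'] using zetaFactor_eq_of_riemannZeta_eq hs hz h h0
    · simp only [hs', hz']
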